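/- arXiv:1907.11987 — 3 statements merged into one kernel-verified Lean document; each statement's English description precedes it below -/
import Mathlib

section
/- Let h : 𝔻 → ℂ be an injective analytic function with h(0) = 0 and h'(0) = a > 0. Then for all w with |w| < a/4 (so that w is in the image of h by the Koebe quarter theorem), |a·h⁻¹(w) - w| ≤ 16|w|² / (a - 4|w|). -/
open Metric Set Filter MeasureTheory Real
open scoped Topology ENNReal

/-- Open mapping theorem for injective holomorphic functions. -/
lemma Complex.nhds_le_map_nhds_of_injOn {f : ℂ → ℂ} {U : Set ℂ} (hU : IsOpen U)
    (hf : DifferentiableOn ℂ f U) (hinj : InjOn f U) {z : ℂ} (hz : z ∈ U) :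
    𝓝 (f z) ≤ map f (𝓝 z) := by
  refine (hf.analyticAt (hU.mem_nhds hz)).eventually_constant_or_nhds_le_map_nhds.resolve_left
    fun hconst ↦ ?_
  have hev : ∀ᶠ y in 𝓝 z, y = z := by
    filter_upwards [hconst, hU.mem_nhds hz] with y hy hyU using hinj hyU hz hy
  obtain ⟨y, hy, hne⟩ := ((hev.filter_mono nhdsWithin_le_nhds).and
    (self_mem_nhdsWithin : {z}ᶜ ∈ 𝓝[≠] z)).exists
  exact hne hy

/-- The inverse of an injective holomorphic function is holomorphic. -/
lemma Complex.differentiableOn_leftInvOn_image {f g : ℂ → ℂ} {U : Set ℂ} (hU : IsOpen U)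
    (hf : DifferentiableOn ℂ f U) (hinv : LeftInvOn g f U) :
    DifferentiableOn ℂ g (f '' U) := by
  have hinj : InjOn f U := hinv.injOn
  have hopen : ∀ z ∈ U, f '' U ∈ 𝓝 (f z) := fun z hz ↦
    Complex.nhds_le_map_nhds_of_injOn hU hf hinj hz (image_mem_map (hU.mem_nhds hz))
  have hcont : ∀ z ∈ U, ContinuousAt g (f z) := fun z hz ↦ by
    rw [ContinuousAt, hinv hz]
    calc map g (𝓝 (f z)) ≤ map g (map f (𝓝 z)) :=
          map_mono (Complex.nhds_le_map_nhds_of_injOn hU hf hinj hz)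
      _ = map id (𝓝 z) := by
          rw [map_map]
          exact map_congr (by filter_upwards [hU.mem_nhds hz] with y hy using hinv hy)
      _ = 𝓝 z := map_id
  have hdiff : ∀ z ∈ U, deriv f z ≠ 0 → DifferentiableAt ℂ g (f z) := fun z hz hne ↦ by
    refine (HasDerivAt.of_local_left_inverse (hcont z hz) (f := f) (f' := deriv f z) ?_ hne
      ?_).differentiableAt
    · rw [hinv hz]
      exact (hf.differentiableAt (hU.mem_nhds hz)).hasDerivAt
    · filter_upwards [hopen z hz]
      rintro _ ⟨y, hy, rfl⟩
      rw [hinv hy]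
  rintro _ ⟨z, hz, rfl⟩
  have hUz := hU.mem_nhds hz
  have hderiv : ∀ᶠ y in 𝓝[≠] z, deriv f y ≠ 0 := by
    refine (hf.analyticAt hUz).deriv.eventually_eq_zero_or_eventually_ne_zero.resolve_left
      fun hzero ↦ ?_
    obtain ⟨r, hr, hball⟩ := Metric.eventually_nhds_iff_ball.1 (hzero.and hUz)
    have hconst : ∀ y ∈ ball z r, f y = f z := fun y hy ↦
      isOpen_ball.is_const_of_deriv_eq_zero (convex_ball z r).isPreconnected
        (hf.mono fun x hx ↦ (hball x hx).2) (fun x hx ↦ (hball x hx).1) hy (mem_ball_self hr)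
    have hev : ∀ᶠ y in 𝓝[≠] z, y = z := by
      filter_upwards [nhdsWithin_le_nhds (ball_mem_nhds z hr)] with y hy
      exact hinj (hball y hy).2 hz (hconst y hy)
    obtain ⟨y, hy, hne⟩ := (hev.and (self_mem_nhdsWithin : {z}ᶜ ∈ 𝓝[≠] z)).exists
    exact hne hy
  refine (Complex.analyticAt_of_differentiable_on_punctured_nhds_of_continuousAt ?_
    (hcont z hz)).differentiableAt.differentiableWithinAt
  have htend : ∀ᶠ w in 𝓝 (f z), g w ≠ z → deriv f (g w) ≠ 0 := by
    have h := hcont z hz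
    rw [ContinuousAt, hinv hz] at h
    exact h.eventually (eventually_nhdsWithin_iff.1 hderiv)
  filter_upwards [nhdsWithin_le_nhds htend, nhdsWithin_le_nhds (hopen z hz),
    self_mem_nhdsWithin] with w hw hwU hne
  obtain ⟨y, hy, rfl⟩ := hwU
  rw [hinv hy] at hw
  exact hdiff y hy (hw fun h ↦ hne (by simp [h]))

/-- Integration over an annulus in polar coordinates. -/
lemma Complex.lintegral_annulus {ρ R : ℝ} (hρ : 0 ≤ ρ) {f : ℂ → ℝ≥0∞}
    (hf : ContinuousOn f {z | ρ < ‖z‖ ∧ ‖z‖ < R}) :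
    ∫⁻ z in {z : ℂ | ρ < ‖z‖ ∧ ‖z‖ < R}, f z =
      ∫⁻ r in Ioo ρ R, ∫⁻ θ in Ioo (-π) π, ENNReal.ofReal r * f (circleMap 0 r θ) := by
  have hA : MeasurableSet {z : ℂ | ρ < ‖z‖ ∧ ‖z‖ < R} :=
    ((isOpen_lt continuous_const continuous_norm).inter
      (isOpen_lt continuous_norm continuous_const)).measurableSet
  have hsymm : ∀ p : ℝ × ℝ, Complex.polarCoord.symm p = circleMap 0 p.1 p.2 := fun p ↦ by
    simp [circleMap, Complex.exp_mul_I]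
  have hprod : MeasurableSet (Ioo ρ R ×ˢ Ioo (-π) π) := measurableSet_Ioo.prod measurableSet_Ioo
  rw [← lintegral_indicator hA, ← Complex.lintegral_comp_polarCoord_symm]
  have hmap : MapsTo (fun p : ℝ × ℝ ↦ circleMap 0 p.1 p.2) (Ioo ρ R ×ˢ Ioo (-π) π)
      {z | ρ < ‖z‖ ∧ ‖z‖ < R} := by
    rintro ⟨r, θ⟩ ⟨hr, -⟩
    simpa [abs_of_pos (hρ.trans_lt hr.1)] using hr
  have hcont : Continuous fun p : ℝ × ℝ ↦ circleMap 0 p.1 p.2 := by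
    unfold circleMap; fun_prop
  have hmeas : AEMeasurable (fun p : ℝ × ℝ ↦ ENNReal.ofReal p.1 * f (circleMap 0 p.1 p.2))
      ((volume.restrict (Ioo ρ R)).prod (volume.restrict (Ioo (-π) π))) := by
    rw [Measure.prod_restrict]
    exact (ENNReal.measurable_ofReal.comp measurable_fst).aemeasurable.mul
      ((hf.comp hcont.continuousOn hmap).aemeasurable hprod)
  rw [← lintegral_prod _ hmeas, Measure.prod_restrict, ← lintegral_indicator hprod,
    ← lintegral_indicator polarCoord.open_target.measurableSet]
  refine lintegral_congr fun p ↦ ?_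
  by_cases hp : p ∈ Ioo ρ R ×ˢ Ioo (-π) π
  · have ht : p ∈ polarCoord.target := ⟨hρ.trans_lt hp.1.1, hp.2⟩
    rw [indicator_of_mem hp, indicator_of_mem ht, hsymm, indicator_of_mem (hmap hp), smul_eq_mul]
  · rw [indicator_of_notMem hp]
    by_cases ht : p ∈ polarCoord.target
    · rw [indicator_of_mem ht, hsymm, indicator_of_notMem, smul_zero]
      rintro ⟨h1, h2⟩
      rw [norm_circleMap_zero, abs_of_pos ht.1] at h1 h2
      exact hp ⟨⟨h1, h2⟩, ht.2⟩
    · rw [indicator_of_notMem ht]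

lemma lintegral_Ioo_ofReal_div {c ρ R : ℝ} (hc : 0 ≤ c) (hρ : 0 < ρ) (hR : ρ ≤ R) :
    ∫⁻ r in Ioo ρ R, ENNReal.ofReal (c / r) = ENNReal.ofReal (c * log (R / ρ)) := by
  have hpos : ∀ r ∈ Icc ρ R, 0 < r := fun r hr ↦ hρ.trans_le hr.1
  have hint : IntegrableOn (fun r ↦ c / r) (Ioo ρ R) := by
    refine (ContinuousOn.integrableOn_Icc ?_).mono_set Ioo_subset_Icc_self
    exact continuousOn_const.div continuousOn_id fun r hr ↦ (hpos r hr).ne'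
  rw [← ofReal_integral_eq_lintegral_ofReal hint, ← integral_Ioc_eq_integral_Ioo,
    ← intervalIntegral.integral_of_le hR]
  · simp_rw [div_eq_mul_inv c]
    rw [intervalIntegral.integral_const_mul, integral_inv_of_pos hρ (hρ.trans_le hR)]
  · filter_upwards [ae_restrict_mem measurableSet_Ioo] with r hr
    exact div_nonneg hc (hpos r (Ioo_subset_Icc_self hr)).le

/-- The area of an annulus in the logarithmic metric `|dw| / |w|`. -/
lemma Complex.lintegral_annulus_enorm_inv_sq {ρ R : ℝ} (hρ : 0 < ρ) (hR : ρ ≤ R) :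
    ∫⁻ z in {z : ℂ | ρ < ‖z‖ ∧ ‖z‖ < R}, ‖z⁻¹‖ₑ ^ 2 =
      ENNReal.ofReal (2 * π * Real.log (R / ρ)) := by
  rw [Complex.lintegral_annulus hρ.le, ← lintegral_Ioo_ofReal_div two_pi_pos.le hρ hR]
  · refine setLIntegral_congr_fun measurableSet_Ioo fun r hr ↦ ?_
    have hr0 : 0 < r := hρ.trans hr.1
    have : ∀ θ, ENNReal.ofReal r * ‖(circleMap 0 r θ)⁻¹‖ₑ ^ 2 = ENNReal.ofReal (1 / r) := by
      intro θ
      rw [← ofReal_norm, ← ENNReal.ofReal_pow (norm_nonneg _),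
        ← ENNReal.ofReal_mul hr0.le, norm_inv, norm_circleMap_zero, abs_of_pos hr0]
      congr 1
      field_simp
    simp only [this, lintegral_const, Measure.restrict_apply_univ, Real.volume_Ioo]
    rw [← ENNReal.ofReal_mul (by positivity)]
    congr 1
    ring
  · exact (ENNReal.continuous_pow 2).comp_continuousOn
      (continuousOn_inv₀.mono fun z hz ↦ norm_pos_iff.1 (hρ.trans hz.1)).enorm

/-- The area of `f '' A` in the logarithmic metric. -/
lemma Complex.lintegral_image_enorm_inv_sq {f : ℂ → ℂ} {A : Set ℂ} (hA : IsOpen A)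
    (hf : DifferentiableOn ℂ f A) (hinj : InjOn f A) :
    ∫⁻ w in f '' A, ‖w⁻¹‖ₑ ^ 2 = ∫⁻ z in A, ‖logDeriv f z‖ₑ ^ 2 := by
  have hderiv : ∀ z ∈ A, HasFDerivWithinAt f
      ((ContinuousLinearMap.toSpanSingleton ℂ (deriv f z)).restrictScalars ℝ) A z := fun z hz ↦
    ((hf.differentiableAt (hA.mem_nhds hz)).hasDerivAt.hasFDerivAt.restrictScalars
      ℝ).hasFDerivWithinAt
  rw [lintegral_image_eq_lintegral_abs_det_fderiv_mul volume hA.measurableSet hderiv hinj]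
  refine setLIntegral_congr_fun hA.measurableSet fun z _ ↦ ?_
  have hdet : ((ContinuousLinearMap.toSpanSingleton ℂ (deriv f z)).restrictScalars ℝ).det =
      ‖deriv f z‖ ^ 2 := by
    rw [ContinuousLinearMap.det, ContinuousLinearMap.coe_restrictScalars,
      LinearMap.det_restrictScalars]
    change Algebra.norm ℝ (ContinuousLinearMap.toSpanSingleton ℂ (deriv f z)).det = _
    rw [ContinuousLinearMap.det_toSpanSingleton, Algebra.norm_complex_eq]
    exact Complex.normSq_eq_norm_sq _
  simp only [hdet, logDeriv_apply, div_eq_mul_inv, enorm_mul, mul_pow]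
  rw [abs_of_nonneg (sq_nonneg _), ENNReal.ofReal_pow (norm_nonneg _), ofReal_norm]

/-- A holomorphic function on the unit disc with `q 0 = 1` has mean square modulus at least `1` on
circles centered at the origin. -/
lemma Complex.ofReal_two_pi_le_lintegral_circleMap {q : ℂ → ℂ}
    (hq : DifferentiableOn ℂ q (ball 0 1)) (hq0 : q 0 = 1) {r : ℝ} (hr0 : 0 < r) (hr1 : r < 1) :
    ENNReal.ofReal (2 * π) ≤ ∫⁻ θ in Ioo (-π) π, ‖q (circleMap 0 r θ)‖ₑ ^ 2 := by
  have hmem : ∀ θ, circleMap 0 r θ ∈ ball (0 : ℂ) 1 := fun θ ↦ by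
    simpa [abs_of_pos hr0] using hr1
  have hcont : Continuous fun θ ↦ q (circleMap 0 r θ) :=
    hq.continuousOn.comp_continuous (continuous_circleMap 0 r) hmem
  have hcont_re : Continuous fun θ ↦ (q (circleMap 0 r θ)).re := Complex.continuous_re.comp hcont
  have hcont_sq : Continuous fun θ ↦ ‖q (circleMap 0 r θ)‖ ^ 2 := hcont.norm.pow 2
  have havg : circleAverage q 0 r = 1 := by
    rw [← hq0]
    refine DiffContOnCl.circleAverage (hq.diffContOnCl_ball ?_)
    rw [abs_of_pos hr0]
    exact closedBall_subset_ball hr1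
  have hmean : ∫ θ in (-π)..π, q (circleMap 0 r θ) = 2 * π := by
    have hper : Function.Periodic (fun θ ↦ q (circleMap 0 r θ)) (2 * π) :=
      (periodic_circleMap 0 r).comp q
    have hshift := hper.intervalIntegral_add_eq (-π) 0
    rw [show -π + 2 * π = π by ring, zero_add] at hshift
    rw [circleAverage_def, ← hshift, inv_smul_eq_iff₀ two_pi_pos.ne'] at havg
    simpa using havg
  have hre : ∫ θ in (-π)..π, (q (circleMap 0 r θ)).re = 2 * π := by
    have h := Complex.reCLM.intervalIntegral_comp_comm (hcont.intervalIntegrable (μ := volume) (-π) π)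
    simp only [Complex.reCLM_apply] at h
    rw [h, hmean]
    simp
  have hsq : 2 * π ≤ ∫ θ in (-π)..π, ‖q (circleMap 0 r θ)‖ ^ 2 := by
    calc 2 * π = ∫ θ in (-π)..π, (2 * (q (circleMap 0 r θ)).re - 1) := by
          rw [intervalIntegral.integral_sub, intervalIntegral.integral_const_mul, hre]
          · simp; ring
          · exact (hcont_re.const_mul 2).intervalIntegrable _ _
          · simp
      _ ≤ _ := by
          refine intervalIntegral.integral_mono_on (by linarith [pi_pos])
            (((hcont_re.const_mul 2).sub continuous_const).intervalIntegrable _ _)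
            (hcont_sq.intervalIntegrable _ _) fun θ _ ↦ ?_
          rw [← Complex.normSq_eq_norm_sq, Complex.normSq_apply]
          nlinarith [sq_nonneg ((q (circleMap 0 r θ)).re - 1),
            sq_nonneg (q (circleMap 0 r θ)).im]
  rw [intervalIntegral.integral_of_le (by linarith [pi_pos]), integral_Ioc_eq_integral_Ioo] at hsq
  have hint : IntegrableOn (fun θ ↦ ‖q (circleMap 0 r θ)‖ ^ 2) (Ioo (-π) π) :=
    hcont_sq.integrableOn_Icc.mono_set Ioo_subset_Icc_self
  refine (ENNReal.ofReal_le_ofReal hsq).trans_eq ?_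
  rw [ofReal_integral_eq_lintegral_ofReal hint (.of_forall fun θ ↦ by positivity)]
  simp_rw [ENNReal.ofReal_pow (norm_nonneg _), ofReal_norm]

/-- Lower bound for the area in the logarithmic metric of the image of an annulus. -/
lemma Complex.ofReal_le_lintegral_annulus_enorm_logDeriv_sq {u : ℂ → ℂ}
    (hu : DifferentiableOn ℂ u (ball 0 1)) (hinj : InjOn u (ball 0 1)) (hu0 : u 0 = 0)
    (hd0 : deriv u 0 ≠ 0) {ρ : ℝ} (hρ0 : 0 < ρ) (hρ1 : ρ < 1) :
    ENNReal.ofReal (2 * π * Real.log (1 / ρ)) ≤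
      ∫⁻ z in {z : ℂ | ρ < ‖z‖ ∧ ‖z‖ < 1}, ‖logDeriv u z‖ₑ ^ 2 := by
  have hball : ball (0 : ℂ) 1 ∈ 𝓝 0 := ball_mem_nhds 0 one_pos
  have hne : ∀ z ∈ ball (0 : ℂ) 1, z ≠ 0 → u z ≠ 0 := fun z hz hz0 huz ↦
    hz0 (hinj hz (mem_ball_self one_pos) (huz.trans hu0.symm))
  have hslope : ∀ z, z ≠ 0 → dslope u 0 z = u z / z := fun z hz ↦ by
    rw [dslope_of_ne _ hz, slope_def_field, hu0, sub_zero, sub_zero]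
  have hslope_ne : ∀ z ∈ ball (0 : ℂ) 1, dslope u 0 z ≠ 0 := fun z hz ↦ by
    rcases eq_or_ne z 0 with rfl | hz0
    · rwa [dslope_same]
    · rw [hslope z hz0]
      exact div_ne_zero (hne z hz hz0) hz0
  have hderiv : DifferentiableOn ℂ (deriv u) (ball 0 1) := hu.deriv isOpen_ball
  have hq : DifferentiableOn ℂ (fun z ↦ deriv u z / dslope u 0 z) (ball 0 1) :=
    hderiv.fun_div ((Complex.differentiableOn_dslope hball).2 hu) hslope_ne
  have hq0 : deriv u 0 / dslope u 0 0 = 1 := by rw [dslope_same, div_self hd0]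
  have hsub : {z : ℂ | ρ < ‖z‖ ∧ ‖z‖ < 1} ⊆ ball 0 1 := fun z hz ↦ by simpa using hz.2
  rw [Complex.lintegral_annulus hρ0.le, ← lintegral_Ioo_ofReal_div two_pi_pos.le hρ0 hρ1.le]
  · refine setLIntegral_mono' measurableSet_Ioo fun r hr ↦ ?_
    have hr0 : 0 < r := hρ0.trans hr.1
    have hpt : ∀ θ, ENNReal.ofReal r * ‖logDeriv u (circleMap 0 r θ)‖ₑ ^ 2 =
        ENNReal.ofReal r⁻¹ *
          ‖deriv u (circleMap 0 r θ) / dslope u 0 (circleMap 0 r θ)‖ₑ ^ 2 := fun θ ↦ by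
      have hc : circleMap 0 r θ ≠ 0 := circleMap_ne_center hr0.ne'
      rw [hslope _ hc, logDeriv_apply, ← ofReal_norm, ← ofReal_norm,
        ← ENNReal.ofReal_pow (norm_nonneg _), ← ENNReal.ofReal_pow (norm_nonneg _),
        ← ENNReal.ofReal_mul hr0.le, ← ENNReal.ofReal_mul (inv_pos.2 hr0).le]
      congr 1
      rw [div_div_eq_mul_div, mul_div_right_comm, norm_mul, norm_circleMap_zero, abs_of_pos hr0]
      field_simp
    simp_rw [hpt]
    rw [lintegral_const_mul' _ _ ENNReal.ofReal_ne_top, div_eq_inv_mul,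
      ENNReal.ofReal_mul (inv_pos.2 hr0).le]
    gcongr
    exact Complex.ofReal_two_pi_le_lintegral_circleMap hq hq0 hr0 hr.2
  · exact (ENNReal.continuous_pow 2).comp_continuousOn
      ((hderiv.continuousOn.mono hsub).div (hu.continuousOn.mono hsub) fun z hz ↦
        hne z (hsub hz) (norm_pos_iff.1 (hρ0.trans hz.1))).enorm

/-- Univalent **Bieberbach–Eilenberg functions**: if `u` is univalent on the unit disc with
`u 0 = 0` and `u z * u z' ≠ 1` for all `z`, `z'`, then `‖deriv u 0‖ ≤ 1`. -/
lemma Complex.norm_deriv_le_one_of_mul_ne_one {u : ℂ → ℂ}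
    (hu : DifferentiableOn ℂ u (ball 0 1)) (hinj : InjOn u (ball 0 1)) (hu0 : u 0 = 0)
    (hmul : ∀ z ∈ ball (0 : ℂ) 1, ∀ z' ∈ ball (0 : ℂ) 1, u z * u z' ≠ 1) :
    ‖deriv u 0‖ ≤ 1 := by
  by_contra! hgt
  have h0 : (0 : ℂ) ∈ ball (0 : ℂ) 1 := mem_ball_self one_pos
  have hball : ball (0 : ℂ) 1 ∈ 𝓝 0 := ball_mem_nhds 0 one_pos
  obtain ⟨β, hβ1, hβ⟩ := exists_between hgt
  have hβ0 : 0 < β := one_pos.trans hβ1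
  obtain ⟨δ, hδ0, hδ⟩ : ∃ δ > 0, ∀ z ∈ ball (0 : ℂ) δ, β < ‖dslope u 0 z‖ ∧ z ∈ ball (0 : ℂ) 1 := by
    have hc : ContinuousAt (fun z ↦ ‖dslope u 0 z‖) 0 :=
      (continuousAt_dslope_same.2 (hu.differentiableAt hball)).norm
    refine Metric.eventually_nhds_iff_ball.1 ((hc.eventually ?_).and hball)
    simp only [dslope_same]
    exact lt_mem_nhds hβ
  obtain ⟨m, hm0, hm⟩ : ∃ m > 0, ball (0 : ℂ) m ⊆ u '' ball 0 δ := by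
    refine Metric.mem_nhds_iff.1 ?_
    have := Complex.nhds_le_map_nhds_of_injOn isOpen_ball hu hinj h0
      (image_mem_map (ball_mem_nhds 0 hδ0))
    rwa [hu0] at this
  obtain ⟨ρ, hρ0, hρ⟩ : ∃ ρ > 0, ρ < min (β⁻¹) (m / β) := exists_between (by positivity)
  have hρβ : β * ρ < 1 := by
    rw [mul_comm, ← lt_div_iff₀ hβ0, one_div]
    exact hρ.trans_le (min_le_left _ _)
  have hρm : β * ρ < m := by
    rw [mul_comm, ← lt_div_iff₀ hβ0]
    exact hρ.trans_le (min_le_right _ _)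
  have hε0 : 0 < β * ρ := by positivity
  have hρ1 : ρ < 1 := by nlinarith
  set A : Set ℂ := {z | ρ < ‖z‖ ∧ ‖z‖ < 1} with hA
  set B : Set ℂ := {z | β * ρ < ‖z‖ ∧ ‖z‖ < (β * ρ)⁻¹} with hB
  have hAopen : IsOpen A := (isOpen_lt continuous_const continuous_norm).inter
    (isOpen_lt continuous_norm continuous_const)
  have hsub : A ⊆ ball 0 1 := fun z hz ↦ by simpa using hz.2
  have hne : ∀ z ∈ A, u z ≠ 0 := fun z hz huz ↦ by
    have := hinj (hsub hz) h0 (huz.trans hu0.symm)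
    simp [hA, this, hρ0.not_gt] at hz
  have hlower : ∀ z ∈ A, β * ρ < ‖u z‖ := fun z hz ↦ by
    by_cases hzδ : z ∈ ball 0 δ
    · have hz0 : z ≠ 0 := norm_pos_iff.1 (hρ0.trans hz.1)
      have h := (hδ z hzδ).1
      rw [dslope_of_ne _ hz0, slope_def_field, hu0, sub_zero, sub_zero, norm_div,
        lt_div_iff₀ (norm_pos_iff.2 hz0)] at h
      exact (mul_lt_mul_of_pos_left hz.1 hβ0).trans h
    · by_contra! hle
      obtain ⟨y, hy, hyz⟩ := hm (mem_ball_zero_iff.2 (hle.trans_lt hρm))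
      exact hzδ (hinj (hδ y hy).2 (hsub hz) hyz ▸ hy)
  have hupper : ∀ z ∈ A, ‖u z‖ < (β * ρ)⁻¹ := fun z hz ↦ by
    by_contra! hle
    have hinv : ‖(u z)⁻¹‖ ≤ β * ρ := by
      rw [norm_inv]
      exact inv_le_of_inv_le₀ hε0 hle
    obtain ⟨y, hy, hyz⟩ := hm (mem_ball_zero_iff.2 (hinv.trans_lt hρm))
    refine hmul z (hsub hz) y (hδ y hy).2 ?_
    rw [hyz, mul_inv_cancel₀ (hne z hz)]
  have huA : DifferentiableOn ℂ u A := hu.mono hsub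
  have hinvA : DifferentiableOn ℂ u⁻¹ A := huA.inv hne
  have hinj_inv : InjOn u⁻¹ A := fun x hx y hy hxy ↦
    hinj (hsub hx) (hsub hy) (inv_injective hxy)
  have hdisj : Disjoint (u '' A) (u⁻¹ '' A) := by
    rw [Set.disjoint_left]
    rintro _ ⟨x, hx, rfl⟩ ⟨y, hy, hxy⟩
    refine hmul x (hsub hx) y (hsub hy) ?_
    rw [← hxy, Pi.inv_apply, inv_mul_cancel₀ (hne y hy)]
  have hmeas : MeasurableSet (u⁻¹ '' A) := measurable_image_of_fderivWithin hAopen.measurableSet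
    (fun z hz ↦ ((hinvA.differentiableAt
      (hAopen.mem_nhds hz)).hasFDerivAt.restrictScalars ℝ).hasFDerivWithinAt) hinj_inv
  have hunion : u '' A ∪ u⁻¹ '' A ⊆ B := by
    rintro _ (⟨z, hz, rfl⟩ | ⟨z, hz, rfl⟩)
    · exact ⟨hlower z hz, hupper z hz⟩
    · have hpos : 0 < ‖u z‖ := norm_pos_iff.2 (hne z hz)
      rw [hB, mem_ofPred_eq, Pi.inv_apply, norm_inv]
      exact ⟨(lt_inv_comm₀ hε0 hpos).2 (hupper z hz), inv_strictAnti₀ hε0 (hlower z hz)⟩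
  have hle : ∫⁻ w in u '' A ∪ u⁻¹ '' A, ‖w⁻¹‖ₑ ^ 2 ≤ ∫⁻ w in B, ‖w⁻¹‖ₑ ^ 2 :=
    lintegral_mono_set hunion
  have hlog_inv : ∀ z ∈ A, ‖logDeriv u⁻¹ z‖ₑ ^ 2 = ‖logDeriv u z‖ₑ ^ 2 := fun z hz ↦ by
    have hinv : logDeriv u⁻¹ z = -logDeriv u z := by
      rw [logDeriv_apply, logDeriv_apply,
        ((huA.differentiableAt (hAopen.mem_nhds hz)).hasDerivAt.inv (hne z hz)).deriv,
        Pi.inv_apply]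
      field_simp [hne z hz]
    simp only [hinv, enorm_neg]
  have hd0 : deriv u 0 ≠ 0 := norm_pos_iff.1 (one_pos.trans hgt)
  have hbound := Complex.ofReal_le_lintegral_annulus_enorm_logDeriv_sq hu hinj hu0 hd0 hρ0 hρ1
  rw [lintegral_union hmeas hdisj, Complex.lintegral_image_enorm_inv_sq hAopen huA
    (hinj.mono hsub), Complex.lintegral_image_enorm_inv_sq hAopen hinvA hinj_inv,
    setLIntegral_congr_fun hAopen.measurableSet hlog_inv,
    Complex.lintegral_annulus_enorm_inv_sq hε0
      (hρβ.le.trans ((one_le_inv₀ hε0).2 hρβ.le))] at hle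
  replace hle := (add_le_add hbound hbound).trans hle
  have hlogρ : 0 < Real.log (1 / ρ) := Real.log_pos ((one_lt_div hρ0).2 hρ1)
  rw [← ENNReal.ofReal_add (by positivity) (by positivity),
    ENNReal.ofReal_le_ofReal_iff', ← mul_add] at hle
  have hlogβ : 0 < Real.log β := Real.log_pos hβ1
  have hexpand : Real.log ((β * ρ)⁻¹ / (β * ρ)) = 2 * Real.log (1 / ρ) - 2 * Real.log β := by
    rw [Real.log_div (inv_pos.2 hε0).ne' hε0.ne', Real.log_inv, Real.log_mul hβ0.ne' hρ0.ne',
      one_div, Real.log_inv]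
    ring
  rcases hle with hle | hle
  · rw [hexpand] at hle
    have := le_of_mul_le_mul_left hle two_pi_pos
    linarith
  · have : 0 < 2 * π * (Real.log (1 / ρ) + Real.log (1 / ρ)) := by positivity
    linarith

/-- **Koebe quarter theorem**. -/
theorem Complex.ball_subset_image_of_injOn {h : ℂ → ℂ}
    (hd : DifferentiableOn ℂ h (ball 0 1)) (hinj : InjOn h (ball 0 1)) (h0 : h 0 = 0) :
    ball 0 (‖deriv h 0‖ / 4) ⊆ h '' ball 0 1 := by
  intro w hw
  by_contra hwim
  have hzero : (0 : ℂ) ∈ ball (0 : ℂ) 1 := mem_ball_self one_pos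
  have hball : ball (0 : ℂ) 1 ∈ 𝓝 0 := ball_mem_nhds 0 one_pos
  have hw0 : w ≠ 0 := fun hw0 ↦ hwim ⟨0, hzero, h0.trans hw0.symm⟩
  have hsc_ball : IsSimplyConnected (ball (0 : ℂ) 1) := by
    have := contractibleSpace_ball (x := (0 : ℂ)) one_pos
    exact inferInstanceAs (SimplyConnectedSpace _)
  obtain ⟨s, hsc, hs⟩ := exists_continuousOn_pow_eq (g := fun z ↦ 1 - h z / w)
    hsc_ball isOpen_ball (continuousOn_const.sub (hd.continuousOn.div_const w)) (fun ⟨z, hz, hzw⟩ ↦ by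
      rw [sub_eq_zero, eq_div_iff hw0, one_mul] at hzw
      exact hwim ⟨z, hz, hzw.symm⟩) two_ne_zero
  wlog hs0 : s 0 = 1 generalizing s
  · refine this (-s) hsc.neg (fun z ↦ by rw [Pi.neg_apply, neg_sq, hs]) ?_
    have h1 : s 0 ^ 2 = 1 := by simp [hs, h0]
    rw [Pi.neg_apply, (sq_eq_one_iff.1 h1).resolve_left hs0, neg_neg]
  have hs_ne : ∀ z ∈ ball (0 : ℂ) 1, s z ≠ 0 := fun z hz hsz ↦ by
    have h1 := hs z
    rw [hsz, zero_pow two_ne_zero, eq_comm, sub_eq_zero, eq_div_iff hw0, one_mul] at h1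
    exact hwim ⟨z, hz, h1.symm⟩
  have heq_of_sq : ∀ z ∈ ball (0 : ℂ) 1, ∀ z' ∈ ball (0 : ℂ) 1, s z ^ 2 = s z' ^ 2 → z = z' := by
    intro z hz z' hz' hzz
    rw [hs, hs, sub_right_inj, div_left_inj' hw0] at hzz
    exact hinj hz hz' hzz
  have hs_deriv : ∀ z ∈ ball (0 : ℂ) 1,
      HasDerivAt s (-(deriv h z / w) / (2 * s z)) z := fun z hz ↦ by
    have hz_nhds := isOpen_ball.mem_nhds hz
    have hp : HasDerivAt (fun y ↦ 1 - h y / w) (-(deriv h z / w)) z :=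
      (((hd.differentiableAt hz_nhds).hasDerivAt).div_const w).const_sub 1
    have hinvd : HasDerivAt (fun x ↦ x ^ 2) (2 * s z) (s z) := by
      simpa using hasDerivAt_pow 2 (s z)
    exact HasDerivAt.of_comp_left (hsc.continuousAt hz_nhds) hinvd hp
      (mul_ne_zero two_ne_zero (hs_ne z hz)) (.of_forall hs)
  have hs_add : ∀ z ∈ ball (0 : ℂ) 1, 1 + s z ≠ 0 := fun z hz hsz ↦ by
    have hsz' : s z = -1 := by linear_combination hsz
    have hz0 := heq_of_sq z hz 0 hzero (by rw [hsz', hs0]; norm_num)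
    rw [hz0, hs0] at hsz
    norm_num at hsz
  have hsd : DifferentiableOn ℂ s (ball 0 1) := fun z hz ↦
    (hs_deriv z hz).differentiableAt.differentiableWithinAt
  set u : ℂ → ℂ := fun z ↦ (1 - s z) / (1 + s z) with hu
  have hud : DifferentiableOn ℂ u (ball 0 1) :=
    (hsd.const_sub 1).fun_div (hsd.const_add 1) hs_add
  have hu_inj : InjOn u (ball 0 1) := fun z hz z' hz' hzz ↦ by
    simp only [hu] at hzz
    rw [div_eq_div_iff (hs_add z hz) (hs_add z' hz')] at hzz
    refine heq_of_sq z hz z' hz' ?_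
    rw [show s z = s z' by linear_combination (-1 / 2) * hzz]
  have hu0 : u 0 = 0 := by simp [hu, hs0]
  have hmul : ∀ z ∈ ball (0 : ℂ) 1, ∀ z' ∈ ball (0 : ℂ) 1, u z * u z' ≠ 1 := by
    intro z hz z' hz' hzz
    simp only [hu] at hzz
    rw [div_mul_div_comm, div_eq_one_iff_eq (mul_ne_zero (hs_add z hz) (hs_add z' hz'))] at hzz
    have hneg : s z = -s z' := by linear_combination (-1 / 2) * hzz
    have heq := heq_of_sq z hz z' hz' (by rw [hneg, neg_sq])
    rw [heq] at hneg
    exact hs_ne z' hz' (by linear_combination (1 / 2) * hneg)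
  have hderiv : deriv u 0 = deriv h 0 / (4 * w) := by
    have h1 := hs_deriv 0 hzero
    have h2 := ((h1.const_sub 1).fun_div (h1.const_add 1) (hs_add 0 hzero)).deriv
    rw [hu, h2, hs0]
    field_simp
    ring
  have hle := Complex.norm_deriv_le_one_of_mul_ne_one hud hu_inj hu0 hmul
  rw [hderiv, norm_div, norm_mul, div_le_one (by simpa using hw0)] at hle
  rw [mem_ball_zero_iff] at hw
  norm_num at hle
  linarith

/-- A form of the **Schwarz–Pick lemma** at the origin. -/
lemma Complex.norm_sub_le_mul_norm_one_sub_conj_mul {k : ℂ → ℂ}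
    (hk : DifferentiableOn ℂ k (ball 0 1)) (hmaps : ∀ z ∈ ball (0 : ℂ) 1, ‖k z‖ ≤ 1)
    (hk0 : ‖k 0‖ < 1) {z : ℂ} (hz : z ∈ ball (0 : ℂ) 1) :
    ‖k z - k 0‖ ≤ ‖z‖ * ‖1 - (starRingEnd ℂ) (k 0) * k z‖ := by
  have hne : ∀ y ∈ ball (0 : ℂ) 1, 1 - (starRingEnd ℂ) (k 0) * k y ≠ 0 := fun y hy h ↦ by
    have h1 : ‖(starRingEnd ℂ) (k 0) * k y‖ = 1 := by rw [← sub_eq_zero.1 h, norm_one]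
    rw [norm_mul, Complex.norm_conj] at h1
    nlinarith [hmaps y hy, norm_nonneg (k 0), norm_nonneg (k y)]
  have hpick : ∀ y ∈ ball (0 : ℂ) 1, ‖k y - k 0‖ ≤ ‖1 - (starRingEnd ℂ) (k 0) * k y‖ := by
    intro y hy
    rw [← sq_le_sq₀ (norm_nonneg _) (norm_nonneg _), ← Complex.normSq_eq_norm_sq,
      ← Complex.normSq_eq_norm_sq]
    have h1 : Complex.normSq (k y) ≤ 1 := by
      rw [Complex.normSq_eq_norm_sq]; exact pow_le_one₀ (norm_nonneg _) (hmaps y hy)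
    have h2 : Complex.normSq (k 0) ≤ 1 := by
      rw [Complex.normSq_eq_norm_sq]; exact pow_le_one₀ (norm_nonneg _) hk0.le
    simp only [Complex.normSq_apply, Complex.sub_re, Complex.sub_im, Complex.mul_re,
      Complex.mul_im, Complex.conj_re, Complex.conj_im, Complex.one_re, Complex.one_im] at h1 h2 ⊢
    nlinarith [mul_nonneg (sub_nonneg.2 h1) (sub_nonneg.2 h2)]
  have hM : DifferentiableOn ℂ (fun y ↦ (k y - k 0) / (1 - (starRingEnd ℂ) (k 0) * k y))
      (ball 0 1) := (hk.sub_const _).fun_div ((hk.const_mul _).const_sub 1) hne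
  have h := Complex.norm_le_norm_of_mapsTo_ball hM (fun y hy ↦ ?_) (by simp)
    (mem_ball_zero_iff.1 hz)
  · rwa [norm_div, div_le_iff₀ (norm_pos_iff.2 (hne z hz))] at h
  · rw [mem_closedBall_zero_iff, norm_div, div_le_one (norm_pos_iff.2 (hne y hy))]
    exact hpick y hy

/-- If `h` is univalent on the unit disc with `h(0) = 0`, `h'(0) = a > 0`, then for
`|w| < a/4` (which lies in the image by the Koebe quarter theorem) the inverse
satisfies `|a·h⁻¹(w) - w| ≤ 16|w|²/(a - 4|w|)`. -/
theorem inverse_estimate (h : ℂ → ℂ) (a : ℝ)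
    (hd : DifferentiableOn ℂ h (ball 0 1))
    (hinj : InjOn h (ball 0 1))
    (h0 : h 0 = 0) (ha : 0 < a) (hderiv : deriv h 0 = (a : ℂ)) :
    ∀ w : ℂ, ‖w‖ < a / 4 → ∀ z ∈ ball (0 : ℂ) 1, h z = w →
      ‖(a : ℂ) * z - w‖ ≤ 16 * ‖w‖ ^ 2 / (a - 4 * ‖w‖) := by
  intro w hw z hz hzw
  have ha0 : (a : ℂ) ≠ 0 := by exact_mod_cast ha.ne'
  have hzero : (0 : ℂ) ∈ ball (0 : ℂ) 1 := mem_ball_self one_pos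
  rcases eq_or_ne w 0 with rfl | hw0
  · simp [hinj hz hzero (hzw.trans h0.symm)]
  have hkoebe := Complex.ball_subset_image_of_injOn hd hinj h0
  rw [hderiv, Complex.norm_real, Real.norm_of_nonneg ha.le] at hkoebe
  set φ : ℂ → ℂ := Function.invFunOn h (ball 0 1)
  have hinv : LeftInvOn φ h (ball 0 1) := hinj.leftInvOn_invFunOn
  have hφ : DifferentiableOn ℂ φ (ball 0 (a / 4)) :=
    (Complex.differentiableOn_leftInvOn_image isOpen_ball hd hinv).mono hkoebe
  have hφ0 : φ 0 = 0 := by simpa [h0] using hinv hzero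
  have hφ_maps : ∀ y ∈ ball (0 : ℂ) (a / 4), φ y ∈ ball (0 : ℂ) 1 := fun y hy ↦ by
    obtain ⟨x, hx, rfl⟩ := hkoebe hy
    rwa [hinv hx]
  have hφ_deriv : deriv φ 0 = (a : ℂ)⁻¹ := by
    have h1 : HasDerivAt h (a : ℂ) 0 := by
      rw [← hderiv]
      exact (hd.differentiableAt (ball_mem_nhds 0 one_pos)).hasDerivAt
    have h2 : HasDerivAt φ (deriv φ 0) (h 0) := by
      rw [h0]
      exact (hφ.differentiableAt (ball_mem_nhds 0 (by positivity))).hasDerivAt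
    have h3 := (h2.comp 0 h1).congr_of_eventuallyEq (f₁ := id) (by
      filter_upwards [ball_mem_nhds (0 : ℂ) one_pos] with y hy using (hinv hy).symm)
    exact eq_inv_of_mul_eq_one_left (h3.unique (hasDerivAt_id 0))
  set g : ℂ → ℂ := fun ζ ↦ φ (a / 4 * ζ) with hg
  have hscale : ∀ ζ ∈ ball (0 : ℂ) 1, (a / 4 * ζ : ℂ) ∈ ball (0 : ℂ) (a / 4) := fun ζ hζ ↦ by
    rw [mem_ball_zero_iff] at hζ ⊢
    rw [norm_mul, norm_div, Complex.norm_real, Real.norm_of_nonneg ha.le]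
    norm_num
    nlinarith
  have hgd : DifferentiableOn ℂ g (ball 0 1) :=
    hφ.comp (differentiableOn_id.const_mul _) hscale
  have hg0 : g 0 = 0 := by simp [hg, hφ0]
  have hg_maps : MapsTo g (ball 0 1) (closedBall (g 0) 1) := fun ζ hζ ↦ by
    rw [hg0]
    exact ball_subset_closedBall (hφ_maps _ (hscale ζ hζ))
  have hk0 : dslope g 0 0 = 1 / 4 := by
    rw [dslope_same, hg, deriv_comp_mul_left, mul_zero, hφ_deriv, smul_eq_mul]
    field_simp
  have hkd : DifferentiableOn ℂ (dslope g 0) (ball 0 1) :=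
    (Complex.differentiableOn_dslope (ball_mem_nhds 0 one_pos)).2 hgd
  have hk_le : ∀ ζ ∈ ball (0 : ℂ) 1, ‖dslope g 0 ζ‖ ≤ 1 := fun ζ hζ ↦ by
    simpa using Complex.norm_dslope_le_div_of_mapsTo_ball hgd hg_maps hζ
  set ζ : ℂ := 4 * w / a with hζ_def
  have hζ_norm : ‖ζ‖ = 4 * ‖w‖ / a := by
    simp [hζ_def, abs_of_pos ha]
  have hζ1 : ‖ζ‖ < 1 := by
    rw [hζ_norm, div_lt_one ha]
    linarith
  have hζ0 : ζ ≠ 0 := by simp [hζ_def, hw0, ha0]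
  have hpick := Complex.norm_sub_le_mul_norm_one_sub_conj_mul hkd hk_le (by rw [hk0]; norm_num)
    (mem_ball_zero_iff.2 hζ1)
  have hgζ : g ζ = z := by
    have : (a / 4 * ζ : ℂ) = h z := by
      rw [hζ_def, hzw]
      field_simp
    simp only [hg]
    rw [this, hinv hz]
  have hkζ : dslope g 0 ζ = z / ζ := by
    rw [dslope_of_ne _ hζ0, slope_def_field, hg0, hgζ, sub_zero, sub_zero]
  have hconj : (starRingEnd ℂ) (1 / 4 : ℂ) = 1 / 4 := by simp [Complex.conj_ofNat]
  have htri : ‖1 - 1 / 4 * (z / ζ)‖ ≤ 15 / 16 + 1 / 4 * ‖z / ζ - 1 / 4‖ := by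
    calc ‖1 - 1 / 4 * (z / ζ)‖ = ‖(15 / 16 : ℂ) - 1 / 4 * (z / ζ - 1 / 4)‖ := by ring_nf
      _ ≤ ‖(15 / 16 : ℂ)‖ + ‖1 / 4 * (z / ζ - 1 / 4)‖ := norm_sub_le _ _
      _ = _ := by rw [norm_mul]; norm_num
  rw [hk0, hconj, hkζ] at hpick
  have hfactor : (a : ℂ) * z - w = a * ζ * (z / ζ - 1 / 4) := by
    have : (w : ℂ) = a * ζ / 4 := by rw [hζ_def]; field_simp
    rw [this]
    field_simp
  have hw_eq : ‖w‖ = a * ‖ζ‖ / 4 := by rw [hζ_norm]; field_simp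
  have hr0 : 0 < ‖ζ‖ := norm_pos_iff.2 hζ0
  rw [hfactor, norm_mul, norm_mul, Complex.norm_real, Real.norm_of_nonneg ha.le, hw_eq,
    show 16 * (a * ‖ζ‖ / 4) ^ 2 / (a - 4 * (a * ‖ζ‖ / 4)) = a * ‖ζ‖ * (‖ζ‖ / (1 - ‖ζ‖)) by
      have : 1 - ‖ζ‖ ≠ 0 := (sub_pos.2 hζ1).ne'
      have h' : a - 4 * (a * ‖ζ‖ / 4) = a * (1 - ‖ζ‖) := by ring
      rw [h']
      field_simp
      ring]
  gcongr
  rw [le_div_iff₀ (sub_pos.2 hζ1)]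
  have hd0 := norm_nonneg (z / ζ - 1 / 4)
  nlinarith [mul_le_mul_of_nonneg_left htri hr0.le, mul_nonneg hr0.le hd0]
end

section
/- Let g : 𝔻 → ℂ be analytic with 0 ∉ g(𝔻) and 1 ∉ g(𝔻). Then for every z ∈ 𝔻, log|g(z)| ≤ (7 + log⁺|g(0)|) · (1+|z|)/(1-|z|), where log⁺ y = max(log y, 0). -/
open Metric Set Filter Topology

/-- A local form of the Schwarz–Pick inequality: if the hyperbolic derivative of a holomorphic map
into the right half-plane has a local maximum at a point of the unit disc, then it is at most `1`
there. -/
lemma norm_deriv_mul_le_of_isLocalMax {F : ℂ → ℂ} {z₀ : ℂ} (hF : AnalyticAt ℂ F z₀)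
    (hre : 0 < (F z₀).re) (hz₀ : ‖z₀‖ < 1)
    (hmax : IsLocalMax (fun z => ‖deriv F z‖ * (1 - ‖z‖ ^ 2) / (F z).re) z₀) :
    ‖deriv F z₀‖ * (1 - ‖z₀‖ ^ 2) / (F z₀).re ≤ 2 := by
  by_contra! hcon
  set m := (F z₀).re with hm
  set c : ℂ := starRingEnd ℂ z₀ with hc
  set d : ℂ := starRingEnd ℂ (F z₀) with hd
  have hone : 0 < 1 - ‖z₀‖ ^ 2 := by nlinarith [norm_nonneg z₀]
  have hsum : F z₀ + d = ((2 * m : ℝ) : ℂ) := Complex.add_conj _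
  have hsum0 : F z₀ + d ≠ 0 := by rw [hsum]; exact_mod_cast (by positivity)
  have hdiff : 1 - c * z₀ = ((1 - ‖z₀‖ ^ 2 : ℝ) : ℂ) := by
    rw [hc, Complex.conj_mul']; push_cast; ring
  have hdiff0 : 1 - c * z₀ ≠ 0 := by rw [hdiff]; exact_mod_cast hone.ne'
  have hFd : HasDerivAt F (deriv F z₀) z₀ := hF.differentiableAt.hasDerivAt
  have hσ : HasDerivAt (fun z => (F z - F z₀) / (F z + d)) (deriv F z₀ / (F z₀ + d)) z₀ := by
    refine ((hFd.sub_const (F z₀)).div (hFd.add_const d) hsum0).congr_deriv ?_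
    rw [sub_self, zero_mul, sub_zero, sq, mul_div_mul_right _ _ hsum0]
  have hslope : ∀ᶠ z in 𝓝[≠] z₀, ‖(1 - c * z)⁻¹‖ <
      ‖slope (fun z => (F z - F z₀) / (F z + d)) z₀ z‖ := by
    have hτ : Tendsto (fun z => ‖(1 - c * z)⁻¹‖) (𝓝[≠] z₀) (𝓝 ‖(1 - c * z₀)⁻¹‖) := by
      have : ContinuousAt (fun z => ‖(1 - c * z)⁻¹‖) z₀ := by fun_prop (disch := exact hdiff0)
      exact this.tendsto.mono_left nhdsWithin_le_nhds
    refine hτ.eventually_lt hσ.tendsto_slope.norm ?_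
    rw [hdiff, hsum, norm_inv, norm_div, Complex.norm_real, Complex.norm_real,
      Real.norm_of_nonneg hone.le, Real.norm_of_nonneg (by positivity), inv_eq_one_div,
      div_lt_div_iff₀ hone (by positivity)]
    rw [lt_div_iff₀ hre] at hcon
    linarith
  set H : ℂ → ℂ := fun z => deriv F z * (1 - c * z) ^ 2 / (F z + d) ^ 2 with hH
  have hHan : AnalyticAt ℂ H z₀ := by
    have := hF.deriv
    exact (this.mul (by fun_prop)).div (by fun_prop) (pow_ne_zero _ hsum0)
  have hlt : ∀ᶠ z in 𝓝[≠] z₀, ‖H z‖ < ‖H z₀‖ := by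
    have hpos : ∀ᶠ z in 𝓝 z₀, 0 < (F z).re ∧ ‖z‖ < 1 := by
      have h1 : ContinuousAt (fun z => (F z).re) z₀ :=
        Complex.continuous_re.continuousAt.comp hF.continuousAt
      exact (h1.eventually (lt_mem_nhds hre)).and
        (continuous_norm.continuousAt.eventually (gt_mem_nhds hz₀))
    filter_upwards [hslope, nhdsWithin_le_nhds hpos, nhdsWithin_le_nhds hmax,
      self_mem_nhdsWithin] with z hs ⟨hFz, hz⟩ hle hne
    have hzz : 0 < 1 - ‖z‖ ^ 2 := by nlinarith [norm_nonneg z]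
    have id1 : ‖F z + d‖ ^ 2 - ‖F z - F z₀‖ ^ 2 = 4 * (F z).re * m := by
      simp only [← Complex.normSq_eq_norm_sq, Complex.normSq_apply, hd, hm, Complex.add_re,
        Complex.add_im, Complex.sub_re, Complex.sub_im, Complex.conj_re, Complex.conj_im]
      ring
    have id2 : ‖1 - c * z‖ ^ 2 - ‖z - z₀‖ ^ 2 = (1 - ‖z‖ ^ 2) * (1 - ‖z₀‖ ^ 2) := by
      simp only [← Complex.normSq_eq_norm_sq, Complex.normSq_apply, hc, Complex.mul_re,
        Complex.mul_im, Complex.sub_re, Complex.sub_im, Complex.conj_re, Complex.conj_im,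
        Complex.one_re, Complex.one_im]
      ring
    have hA : 0 < ‖F z + d‖ := by
      have : 0 < 4 * (F z).re * m := by positivity
      exact (norm_nonneg _).lt_of_ne fun h => by rw [← h] at id1; nlinarith [sq_nonneg ‖F z - F z₀‖]
    have hB : 0 < ‖1 - c * z‖ := by
      have : 0 < (1 - ‖z‖ ^ 2) * (1 - ‖z₀‖ ^ 2) := by positivity
      exact (norm_nonneg _).lt_of_ne fun h => by rw [← h] at id2; nlinarith [sq_nonneg ‖z - z₀‖]
    have hne' : 0 < ‖z - z₀‖ := norm_pos_iff.2 (sub_ne_zero.2 hne)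
    have hs' : ‖z - z₀‖ * ‖F z + d‖ < ‖F z - F z₀‖ * ‖1 - c * z‖ := by
      simp only [slope_def_field, sub_self, zero_div, sub_zero, norm_div, norm_inv] at hs
      rw [div_div, inv_eq_one_div, div_lt_div_iff₀ hB (by positivity)] at hs
      linarith
    have hs2 : ‖z - z₀‖ ^ 2 * ‖F z + d‖ ^ 2 < ‖F z - F z₀‖ ^ 2 * ‖1 - c * z‖ ^ 2 := by
      rw [← mul_pow, ← mul_pow]; gcongr
    have key : 4 * (F z).re * m * ‖1 - c * z‖ ^ 2 <
        (1 - ‖z‖ ^ 2) * (1 - ‖z₀‖ ^ 2) * ‖F z + d‖ ^ 2 := by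
      rw [← id1, ← id2]; nlinarith
    have hD : 0 < ‖deriv F z₀‖ := by
      refine (norm_nonneg _).lt_of_ne fun h => ?_
      rw [← h] at hcon; norm_num at hcon
    have hH0 : ‖H z₀‖ = ‖deriv F z₀‖ * (1 - ‖z₀‖ ^ 2) ^ 2 / (2 * m) ^ 2 := by
      simp only [hH]
      rw [norm_div, norm_mul, norm_pow, norm_pow, hdiff, hsum, Complex.norm_real,
        Complex.norm_real, Real.norm_of_nonneg hone.le, Real.norm_of_nonneg (by positivity)]
    have hHz : ‖H z‖ = ‖deriv F z‖ * ‖1 - c * z‖ ^ 2 / ‖F z + d‖ ^ 2 := by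
      simp only [hH, norm_div, norm_mul, norm_pow]
    rw [hH0, hHz, div_lt_div_iff₀ (by positivity) (by positivity)]
    have hle' : ‖deriv F z‖ * (1 - ‖z‖ ^ 2) * m ≤
        ‖deriv F z₀‖ * (1 - ‖z₀‖ ^ 2) * (F z).re := by
      have : ‖deriv F z‖ * (1 - ‖z‖ ^ 2) / (F z).re ≤
        ‖deriv F z₀‖ * (1 - ‖z₀‖ ^ 2) / m := hle
      rwa [div_le_div_iff₀ hFz hre] at this
    have e1 := mul_le_mul_of_nonneg_right hle' (by positivity : 0 ≤ 4 * m * ‖1 - c * z‖ ^ 2)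
    have e2 := mul_lt_mul_of_pos_left key (by positivity : 0 < ‖deriv F z₀‖ * (1 - ‖z₀‖ ^ 2))
    refine lt_of_mul_lt_mul_right (a := 1 - ‖z‖ ^ 2) ?_ hzz.le
    nlinarith [e1, e2]
  have hloc : IsLocalMax (norm ∘ H) z₀ := by
    have := eventually_nhdsWithin_iff.1 hlt
    filter_upwards [this] with z hz
    rcases eq_or_ne z z₀ with rfl | hne
    · exact le_rfl
    · exact (hz hne).le
  have hconst := Complex.eventually_eq_of_isLocalMax_norm
    (hHan.eventually_analyticAt.mono fun z hz => hz.differentiableAt) hloc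
  obtain ⟨z, h1, h2⟩ := (hlt.and (nhdsWithin_le_nhds hconst)).exists
  rw [h2] at h1
  exact lt_irrefl _ h1

namespace ThricePuncturedSphere

/-- The three sides `1`, `w`, `1 - w` of the triangle with vertices `0`, `1`, `w`. -/
def side (i : Fin 3) (w : ℂ) : ℂ := ![1, w, 1 - w] i

/-- A function on `ℂ \ {0, 1}` with a double pole at one of the three punctures and simple zeros
at the two others. -/
noncomputable def cusp (i : Fin 3) (w : ℂ) : ℂ := w * (1 - w) / side i w ^ 3

/-- The numerator of the logarithmic derivative of `cusp`. -/
def numer (i : Fin 3) (w : ℂ) : ℂ := ![1 - 2 * w, w - 2, 1 + w] i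

/-- The height of `w` in the neighbourhood of a puncture. -/
noncomputable def height (i : Fin 3) (w : ℂ) : ℝ := 6 + Real.log ‖cusp i w‖ / 2

lemma side_ne_zero {w : ℂ} (h0 : w ≠ 0) (h1 : w ≠ 1) (i : Fin 3) : side i w ≠ 0 := by
  fin_cases i <;> simp [side, h0, sub_ne_zero, h1.symm]

lemma cusp_ne_zero {w : ℂ} (h0 : w ≠ 0) (h1 : w ≠ 1) (i : Fin 3) : cusp i w ≠ 0 :=
  div_ne_zero (mul_ne_zero h0 (sub_ne_zero.2 h1.symm)) (pow_ne_zero _ (side_ne_zero h0 h1 i))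

lemma continuous_side (i : Fin 3) : Continuous (side i) := by
  fin_cases i
  · exact continuous_const
  · exact continuous_id
  · exact continuous_const.sub continuous_id

lemma continuous_numer (i : Fin 3) : Continuous (numer i) := by
  fin_cases i
  · exact continuous_const.sub (continuous_const.mul continuous_id)
  · exact continuous_id.sub continuous_const
  · exact continuous_const.add continuous_id

lemma hasDerivAt_cusp {w : ℂ} (h0 : w ≠ 0) (h1 : w ≠ 1) (i : Fin 3) :
    HasDerivAt (cusp i) (cusp i w * (numer i w / (w * (1 - w)))) w := by
  have h1' : 1 - w ≠ 0 := sub_ne_zero.2 h1.symm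
  have hnum : HasDerivAt (fun w : ℂ => w * (1 - w)) (1 * (1 - w) + w * (-1)) w :=
    (hasDerivAt_id w).mul ((hasDerivAt_id w).const_sub 1)
  have key : ∀ s' : ℂ, HasDerivAt (side i) s' w →
      numer i w * side i w = (1 - 2 * w) * side i w - 3 * s' * (w * (1 - w)) →
      HasDerivAt (cusp i) (cusp i w * (numer i w / (w * (1 - w)))) w := by
    intro s' hs heq
    have hs0 := side_ne_zero h0 h1 i
    refine (hnum.div (hs.pow 3) (pow_ne_zero 3 hs0)).congr_deriv ?_
    simp only [cusp, Pi.pow_apply]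
    field_simp
    push_cast
    linear_combination -side i w ^ 2 * heq
  fin_cases i
  · exact key 0 (hasDerivAt_const w _) (by simp [numer, side])
  · exact key 1 (hasDerivAt_id w) (by simp [numer, side]; ring)
  · exact key (-1) ((hasDerivAt_id w).const_sub 1) (by simp [numer, side]; ring)

lemma log_norm_cusp {w : ℂ} (h0 : w ≠ 0) (h1 : w ≠ 1) (i : Fin 3) :
    Real.log ‖cusp i w‖ =
      Real.log ‖w‖ + Real.log ‖1 - w‖ - 3 * Real.log ‖side i w‖ := by
  have h1' : 1 - w ≠ 0 := sub_ne_zero.2 h1.symm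
  have hs0 := side_ne_zero h0 h1 i
  rw [cusp, norm_div, norm_mul, norm_pow, Real.log_div (by positivity) (by positivity),
    Real.log_mul (by positivity) (by positivity), Real.log_pow]
  norm_num

lemma div_height_le_of_sides {a b c E E' : ℝ} (ha : 0 < a) (hb : 0 < b) (hc : 0 < c)
    (hca : c ≤ a) (hcb : c ≤ b) (hac : a ≤ 11 / 10 * c) (hbac : b ≤ a + c)
    (hE : 0 ≤ E) (hE' : 0 ≤ E') (hE2 : E ^ 2 = 2 * b ^ 2 + 2 * c ^ 2 - a ^ 2)
    (hE2' : E' ^ 2 = 2 * a ^ 2 + 2 * b ^ 2 - c ^ 2) :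
    E / (6 + (Real.log a + Real.log b + Real.log c - 3 * Real.log a) / 2) ≤
      E' / (6 + (Real.log a + Real.log b + Real.log c - 3 * Real.log c) / 2) := by
  have hla : Real.log c ≤ Real.log a := Real.log_le_log hc hca
  have hlb : Real.log c ≤ Real.log b := Real.log_le_log hc hcb
  have hlog : Real.log a - Real.log c ≤ a / c - 1 := by
    rw [← Real.log_div ha.ne' hc.ne']; exact Real.log_le_sub_one_of_pos (by positivity)
  have hx : a / c - 1 ≤ 1 / 10 := by
    have : a / c ≤ 11 / 10 := by rw [div_le_iff₀ hc]; linarith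
    linarith
  set K := 6 + (Real.log a + Real.log b + Real.log c - 3 * Real.log c) / 2 with hK
  have hK6 : 6 ≤ K := by rw [hK]; linarith
  have hK' : 6 + (Real.log a + Real.log b + Real.log c - 3 * Real.log a) / 2 =
      K - 3 / 2 * (Real.log a - Real.log c) := by rw [hK]; ring
  rw [hK', div_le_div_iff₀ (by linarith) (by linarith)]
  have hEE : E ≤ E' := by
    refine (sq_le_sq₀ hE hE').1 ?_
    nlinarith
  have hE'pos : 0 < E' := hE'.lt_of_ne fun h => by rw [← h] at hE2'; nlinarith
  suffices h : 3 / 2 * (a / c - 1) * E' ≤ 6 * (E' - E) by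
    nlinarith [mul_le_mul_of_nonneg_right hlog hE',
      mul_le_mul_of_nonneg_right hK6 (sub_nonneg.2 hEE)]
  have hdiff : (E' - E) * (2 * E') ≥ 3 * (a ^ 2 - c ^ 2) := by nlinarith
  have hbound : E' ^ 2 ≤ 6 * (a + c) * c := by
    rw [hE2']
    have : b ^ 2 ≤ (a + c) ^ 2 := by gcongr
    nlinarith
  have hmul : (a / c - 1) * c = a - c := by field_simp
  refine le_of_mul_le_mul_right (a := 2 * E' * c) ?_ (by positivity)
  calc 3 / 2 * (a / c - 1) * E' * (2 * E' * c) = 3 * (a - c) * E' ^ 2 := by rw [← hmul]; ring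
    _ ≤ 3 * (a - c) * (6 * (a + c) * c) :=
      mul_le_mul_of_nonneg_left hbound (by linarith)
    _ ≤ 6 * (E' - E) * (2 * E' * c) := by nlinarith

lemma numer_div_height_le {w : ℂ} (h0 : w ≠ 0) (h1 : w ≠ 1) {i j : Fin 3}
    (hj : ∀ k, ‖side j w‖ ≤ ‖side k w‖) (hi : ‖side i w‖ ≤ 11 / 10 * ‖side j w‖) :
    ‖numer i w‖ / height i w ≤ ‖numer j w‖ / height j w := by
  have e0 : ‖1 - 2 * w‖ ^ 2 = 2 * ‖w‖ ^ 2 + 2 * ‖1 - w‖ ^ 2 - 1 := by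
    simp [← Complex.normSq_eq_norm_sq, Complex.normSq_apply]; ring
  have e1 : ‖w - 2‖ ^ 2 = 2 * ‖1 - w‖ ^ 2 + 2 - ‖w‖ ^ 2 := by
    simp [← Complex.normSq_eq_norm_sq, Complex.normSq_apply]; ring
  have e2 : ‖1 + w‖ ^ 2 = 2 * ‖w‖ ^ 2 + 2 - ‖1 - w‖ ^ 2 := by
    simp [← Complex.normSq_eq_norm_sq, Complex.normSq_apply]; ring
  have t0 : 1 ≤ ‖w‖ + ‖1 - w‖ := by simpa using norm_add_le w (1 - w)
  have t1 : ‖w‖ ≤ 1 + ‖1 - w‖ := by simpa using norm_sub_le (1 : ℂ) (1 - w)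
  have t2 : ‖1 - w‖ ≤ 1 + ‖w‖ := by simpa using norm_sub_le (1 : ℂ) w
  have ha : 0 < ‖w‖ := norm_pos_iff.2 h0
  have hb : 0 < ‖1 - w‖ := norm_pos_iff.2 (sub_ne_zero.2 h1.symm)
  have hj0 := hj 0
  have hj1 := hj 1
  have hj2 := hj 2
  simp only [height, log_norm_cusp h0 h1]
  rcases eq_or_ne i j with rfl | hij
  · exact le_rfl
  have key : ∀ {a b c E E' : ℝ}, 0 < a → 0 < b → 0 < c → c ≤ a → c ≤ b → a ≤ 11 / 10 * c →
      b ≤ a + c → 0 ≤ E → 0 ≤ E' → E ^ 2 = 2 * b ^ 2 + 2 * c ^ 2 - a ^ 2 →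
      E' ^ 2 = 2 * a ^ 2 + 2 * b ^ 2 - c ^ 2 →
      Real.log a + Real.log b + Real.log c = Real.log ‖w‖ + Real.log ‖1 - w‖ →
      E / (6 + (Real.log ‖w‖ + Real.log ‖1 - w‖ - 3 * Real.log a) / 2) ≤
      E' / (6 + (Real.log ‖w‖ + Real.log ‖1 - w‖ - 3 * Real.log c) / 2) := by
    intro a b c E E' ha hb hc hca hcb hac hbac hE hE' hE2 hE2' hlog
    rw [← hlog]
    exact div_height_le_of_sides ha hb hc hca hcb hac hbac hE hE' hE2 hE2'
  fin_cases i <;> fin_cases j <;> simp [side, numer] at hij hj0 hj1 hj2 hi ⊢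
  · simpa using key (a := 1) (b := ‖1 - w‖) (c := ‖w‖) (E := ‖1 - 2 * w‖) (E' := ‖w - 2‖)
      one_pos hb ha (by linarith) (by linarith) (by linarith) (by linarith) (norm_nonneg _)
      (norm_nonneg _) (by linarith) (by linarith) (by simp; try ring)
  · simpa using key (a := 1) (b := ‖w‖) (c := ‖1 - w‖) (E := ‖1 - 2 * w‖) (E' := ‖1 + w‖)
      one_pos ha hb (by linarith) (by linarith) (by linarith) (by linarith) (norm_nonneg _)
      (norm_nonneg _) (by linarith) (by linarith) (by simp; try ring)
  · simpa using key (a := ‖w‖) (b := ‖1 - w‖) (c := 1) (E := ‖w - 2‖) (E' := ‖1 - 2 * w‖)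
      ha hb one_pos (by linarith) (by linarith) (by linarith) (by linarith) (norm_nonneg _)
      (norm_nonneg _) (by linarith) (by linarith) (by simp; try ring)
  · simpa using key (a := ‖w‖) (b := 1) (c := ‖1 - w‖) (E := ‖w - 2‖) (E' := ‖1 + w‖)
      ha one_pos hb (by linarith) (by linarith) (by linarith) (by linarith) (norm_nonneg _)
      (norm_nonneg _) (by linarith) (by linarith) (by simp; try ring)
  · simpa using key (a := ‖1 - w‖) (b := ‖w‖) (c := 1) (E := ‖1 + w‖) (E' := ‖1 - 2 * w‖)
      hb ha one_pos (by linarith) (by linarith) (by linarith) (by linarith) (norm_nonneg _)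
      (norm_nonneg _) (by linarith) (by linarith) (by simp; try ring)
  · simpa using key (a := ‖1 - w‖) (b := 1) (c := ‖w‖) (E := ‖1 + w‖) (E' := ‖w - 2‖)
      hb one_pos ha (by linarith) (by linarith) (by linarith) (by linarith) (norm_nonneg _)
      (norm_nonneg _) (by linarith) (by linarith) (by simp; try ring)

lemma six_le_height {w : ℂ} (h0 : w ≠ 0) (h1 : w ≠ 1) {i : Fin 3}
    (hi : ∀ k, ‖side i w‖ ≤ ‖side k w‖) : 6 ≤ height i w := by
  have hlog : ∀ k, Real.log ‖side i w‖ ≤ Real.log ‖side k w‖ := fun k =>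
    Real.log_le_log (norm_pos_iff.2 (side_ne_zero h0 h1 i)) (hi k)
  have l0 : Real.log ‖side i w‖ ≤ 0 := by simpa [side] using hlog 0
  have l1 : Real.log ‖side i w‖ ≤ Real.log ‖w‖ := hlog 1
  have l2 : Real.log ‖side i w‖ ≤ Real.log ‖1 - w‖ := hlog 2
  rw [height, log_norm_cusp h0 h1]
  linarith

/-- The ratio of the pullback under `g` of the conformal metric near a puncture to half the
hyperbolic metric of the unit disc. -/
noncomputable def dens (g : ℂ → ℂ) (i : Fin 3) (z : ℂ) : ℝ :=
  ‖numer i (g z)‖ / height i (g z) * (‖deriv g z‖ / (2 * ‖g z‖ * ‖1 - g z‖) * (1 - ‖z‖ ^ 2))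

lemma dens_le_two_of_isLocalMax {g : ℂ → ℂ} {z₀ : ℂ} {i : Fin 3} (hg : AnalyticAt ℂ g z₀)
    (h0 : g z₀ ≠ 0) (h1 : g z₀ ≠ 1) (hh : 0 < height i (g z₀)) (hz₀ : ‖z₀‖ < 1)
    (hmax : IsLocalMax (dens g i) z₀) : dens g i z₀ ≤ 2 := by
  set q₀ := cusp i (g z₀) with hq₀
  have hq₀0 : q₀ ≠ 0 := cusp_ne_zero h0 h1 i
  set F : ℂ → ℂ := fun z => (height i (g z₀) : ℂ) + Complex.log (cusp i (g z) / q₀) / 2 with hF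
  have hcont : ContinuousAt (fun z => cusp i (g z) / q₀) z₀ :=
    ((hasDerivAt_cusp h0 h1 i).continuousAt.comp' hg.continuousAt).div_const q₀
  have hgood : ∀ᶠ z in 𝓝 z₀, g z ≠ 0 ∧ g z ≠ 1 ∧ DifferentiableAt ℂ g z ∧
      cusp i (g z) / q₀ ∈ Complex.slitPlane := by
    refine (hg.continuousAt.eventually_ne h0).and ((hg.continuousAt.eventually_ne h1).and
      ((hg.eventually_analyticAt.mono fun z hz => hz.differentiableAt).and
      (hcont.eventually_mem (Complex.isOpen_slitPlane.mem_nhds ?_))))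
    simp [← hq₀, div_self hq₀0]
  have hderiv : ∀ᶠ z in 𝓝 z₀, HasDerivAt F
      (numer i (g z) * deriv g z / (2 * g z * (1 - g z))) z := by
    filter_upwards [hgood] with z ⟨hz0, hz1, hd, hs⟩
    have hz1' : 1 - g z ≠ 0 := sub_ne_zero.2 hz1.symm
    have hcz := cusp_ne_zero hz0 hz1 i
    have := ((((hasDerivAt_cusp hz0 hz1 i).comp z hd.hasDerivAt).div_const q₀).clog hs).div_const 2
    refine (this.const_add (height i (g z₀) : ℂ)).congr_deriv ?_
    simp only [Function.comp]
    field_simp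
  have hre : ∀ᶠ z in 𝓝 z₀, (F z).re = height i (g z) := by
    filter_upwards [hgood] with z ⟨hz0, hz1, _⟩
    have hcz := cusp_ne_zero hz0 hz1 i
    have : (F z).re = height i (g z₀) + Real.log ‖cusp i (g z) / q₀‖ / 2 := by
      simp [hF, Complex.log_re]
    rw [this, norm_div, Real.log_div (norm_ne_zero_iff.2 hcz) (norm_ne_zero_iff.2 hq₀0), height,
      height]
    ring
  have heq : (fun z => ‖deriv F z‖ * (1 - ‖z‖ ^ 2) / (F z).re) =ᶠ[𝓝 z₀] dens g i := by
    filter_upwards [hderiv, hre] with z hz1 hz2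
    rw [hz1.deriv, hz2, dens, norm_div, norm_mul, norm_mul, norm_mul, Complex.norm_ofNat]
    ring
  have hFan : AnalyticAt ℂ F z₀ := by
    rw [Complex.analyticAt_iff_eventually_differentiableAt]
    exact hderiv.mono fun z hz => hz.differentiableAt
  rw [← heq.eq_of_nhds]
  exact norm_deriv_mul_le_of_isLocalMax hFan (by rwa [hre.self_of_nhds]) hz₀
    (hmax.congr (heq.mono fun z hz => hz.symm))

lemma continuousOn_dens {g : ℂ → ℂ} {s : Set ℂ} (hg : ContinuousOn g s)
    (hg' : ContinuousOn (deriv g) s) (h0 : ∀ z ∈ s, g z ≠ 0) (h1 : ∀ z ∈ s, g z ≠ 1) {i : Fin 3}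
    (hi : ∀ z ∈ s, ∀ k, ‖side i (g z)‖ ≤ ‖side k (g z)‖) : ContinuousOn (dens g i) s := by
  have hc : ContinuousOn (fun z => cusp i (g z)) s := fun z hz =>
    (hasDerivAt_cusp (h0 z hz) (h1 z hz) i).continuousAt.comp_continuousWithinAt (hg z hz)
  have hh : ContinuousOn (fun z => height i (g z)) s :=
    continuousOn_const.add ((hc.norm.log fun z hz =>
      norm_ne_zero_iff.2 (cusp_ne_zero (h0 z hz) (h1 z hz) i)).div_const 2)
  refine (((continuous_numer i).comp_continuousOn hg).norm.div hh fun z hz => ?_).mul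
    ((hg'.norm.div ((continuousOn_const.mul hg.norm).mul (continuousOn_const.sub hg).norm)
      fun z hz => ?_).mul (by fun_prop))
  · linarith [six_le_height (h0 z hz) (h1 z hz) (hi z hz)]
  · have := norm_pos_iff.2 (h0 z hz)
    have := norm_pos_iff.2 (sub_ne_zero.2 (h1 z hz).symm)
    change 2 * ‖g z‖ * ‖1 - g z‖ ≠ 0
    positivity

lemma dens_le_two {g : ℂ → ℂ} {R : ℝ} (hR : 1 < R) (hg : DifferentiableOn ℂ g (ball 0 R))
    (h0 : ∀ z ∈ ball (0 : ℂ) R, g z ≠ 0) (h1 : ∀ z ∈ ball (0 : ℂ) R, g z ≠ 1) {z : ℂ}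
    (hz : z ∈ closedBall (0 : ℂ) 1) {i : Fin 3} (hi : ∀ k, ‖side i (g z)‖ ≤ ‖side k (g z)‖) :
    dens g i z ≤ 2 := by
  have hsub : closedBall (0 : ℂ) 1 ⊆ ball 0 R := closedBall_subset_ball hR
  have hcg : ContinuousOn g (closedBall 0 1) := hg.continuousOn.mono hsub
  have hcg' : ContinuousOn (deriv g) (closedBall 0 1) :=
    (hg.deriv isOpen_ball).continuousOn.mono hsub
  set K : Fin 3 → Set ℂ := fun i =>
    {z ∈ closedBall (0 : ℂ) 1 | ∀ k, ‖side i (g z)‖ ≤ ‖side k (g z)‖} with hK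
  have hKsub : ∀ i, K i ⊆ closedBall 0 1 := fun i z hz => hz.1
  have hKc : ∀ i, IsCompact (K i) := by
    intro i
    have hside : ∀ k, ContinuousOn (fun z => ‖side k (g z)‖) (closedBall 0 1) := fun k =>
      ((continuous_side k).comp_continuousOn hcg).norm
    have : K i = ⋂ k, {z ∈ closedBall (0 : ℂ) 1 | ‖side i (g z)‖ ≤ ‖side k (g z)‖} := by
      ext z; simp [hK, forall_and]
    rw [this]
    refine (isCompact_closedBall (0 : ℂ) 1).of_isClosed_subset
      (isClosed_iInter fun k => isClosed_closedBall.isClosed_le (hside i) (hside k)) ?_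
    exact (iInter_subset _ 0).trans fun z hz => hz.1
  have hV : IsCompact (⋃ i, dens g i '' K i) := isCompact_iUnion fun i =>
    (hKc i).image_of_continuousOn (continuousOn_dens (hcg.mono (hKsub i)) (hcg'.mono (hKsub i))
      (fun z hz => h0 z (hsub hz.1)) (fun z hz => h1 z (hsub hz.1)) fun z hz => hz.2)
  have hmem : ∀ {i z}, z ∈ K i → dens g i z ∈ ⋃ i, dens g i '' K i := fun {i z} hz =>
    mem_iUnion.2 ⟨i, mem_image_of_mem _ hz⟩
  have hzi : z ∈ K i := ⟨hz, hi⟩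
  obtain ⟨M, hM, hMmax⟩ := hV.exists_isGreatest ⟨_, hmem hzi⟩
  refine (hMmax (hmem hzi)).trans ?_
  obtain ⟨j, z₀, hz₀, rfl⟩ := mem_iUnion.1 hM
  have hz₀R := hsub hz₀.1
  rcases (mem_closedBall_zero_iff.1 hz₀.1).eq_or_lt with heq | hlt
  · simp [dens, heq]
  have han : AnalyticAt ℂ g z₀ := hg.analyticAt (isOpen_ball.mem_nhds hz₀R)
  have hheight := six_le_height (h0 z₀ hz₀R) (h1 z₀ hz₀R) hz₀.2
  refine dens_le_two_of_isLocalMax han (h0 z₀ hz₀R) (h1 z₀ hz₀R) (by linarith) hlt ?_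
  have hnear : ∀ᶠ z in 𝓝 z₀, ∀ k, ‖side j (g z)‖ < 11 / 10 * ‖side k (g z)‖ := by
    refine eventually_all.2 fun k => ?_
    have hside : ∀ k, ContinuousAt (fun z => ‖side k (g z)‖) z₀ := fun k =>
      ((continuous_side k).continuousAt.comp' han.continuousAt).norm
    refine (hside j).eventually_lt ((hside k).const_mul (11 / 10)) ?_
    have := norm_pos_iff.2 (side_ne_zero (h0 z₀ hz₀R) (h1 z₀ hz₀R) k)
    linarith [hz₀.2 k]
  filter_upwards [hnear, isOpen_ball.mem_nhds (mem_ball_zero_iff.2 hlt)] with y hy hy1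
  have hyc := ball_subset_closedBall hy1
  obtain ⟨k, hk⟩ := Finite.exists_min fun k => ‖side k (g y)‖
  refine le_trans ?_ (hMmax (hmem (i := k) ⟨hyc, hk⟩))
  refine mul_le_mul_of_nonneg_right
    (numer_div_height_le (h0 y (hsub hyc)) (h1 y (hsub hyc)) hk (hy k).le) ?_
  have : ‖y‖ < 1 := mem_ball_zero_iff.1 hy1
  have : 0 ≤ 1 - ‖y‖ ^ 2 := by nlinarith [norm_nonneg y]
  positivity

lemma hasDerivAt_log_norm {f : ℝ → ℂ} {f' : ℂ} {t : ℝ} (hf : HasDerivAt f f' t) (h0 : f t ≠ 0) :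
    HasDerivAt (fun t => Real.log ‖f t‖) (inner ℝ (f t) f' / ‖f t‖ ^ 2) t := by
  have hn : ‖f t‖ ≠ 0 := norm_ne_zero_iff.2 h0
  have := (hf.norm_sq.log (pow_ne_zero 2 hn)).div_const 2
  refine (this.congr_deriv (by field_simp)).congr_of_eventuallyEq (.of_forall fun s => ?_)
  simp only [Real.log_pow]
  push_cast
  ring

lemma log_two_le_one : Real.log 2 ≤ 1 := by
  linarith [Real.log_le_sub_one_of_pos (two_pos : (0 : ℝ) < 2)]

lemma log_norm_add_log_norm_le {w : ℂ} {L : ℝ} (hL : 0 ≤ L)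
    (hw : Real.log ‖w‖ ≤ L ∨ ‖w‖ ≤ 1 ∨ ‖1 - w‖ ≤ 1) :
    Real.log ‖w‖ + Real.log ‖1 - w‖ ≤ 2 + 2 * L := by
  have log_le_one : ∀ {x : ℝ}, 0 ≤ x → x ≤ 2 → Real.log x ≤ 1 := fun {x} hx0 hx => by
    rcases hx0.eq_or_lt with rfl | hpos
    · simp
    · exact (Real.log_le_log hpos hx).trans log_two_le_one
  have t2 : ‖1 - w‖ ≤ 1 + ‖w‖ := by simpa using norm_sub_le (1 : ℂ) w
  by_cases h1 : ‖w‖ ≤ 1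
  · have := Real.log_nonpos (norm_nonneg w) h1
    have := log_le_one (norm_nonneg (1 - w)) (by linarith)
    linarith
  by_cases h2 : ‖1 - w‖ ≤ 1
  · have t1 : ‖w‖ ≤ 1 + ‖1 - w‖ := by simpa using norm_sub_le (1 : ℂ) (1 - w)
    have := Real.log_nonpos (norm_nonneg (1 - w)) h2
    have := log_le_one (norm_nonneg w) (by linarith)
    linarith
  push Not at h1 h2
  have hlog : Real.log ‖w‖ ≤ L := by
    rcases hw with h | h | h <;> linarith
  have : Real.log ‖1 - w‖ ≤ Real.log (2 * ‖w‖) := Real.log_le_log (by linarith) (by linarith)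
  rw [Real.log_mul two_ne_zero (by linarith)] at this
  linarith [log_two_le_one]

lemma antitoneOn_height_mul {g : ℂ → ℂ} {R : ℝ} (hR : 1 < R)
    (hg : DifferentiableOn ℂ g (ball 0 R)) (h0 : ∀ z ∈ ball (0 : ℂ) R, g z ≠ 0)
    (h1 : ∀ z ∈ ball (0 : ℂ) R, g z ≠ 1) {z : ℂ} (hz : ‖z‖ < 1) {t₀ : ℝ} (ht₀ : 0 ≤ t₀)
    (hlarge : ∀ t ∈ Ioo t₀ 1, 1 ≤ ‖g (t * z)‖ ∧ 1 ≤ ‖1 - g (t * z)‖) :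
    AntitoneOn (fun t : ℝ => height 0 (g (t * z)) * ((1 - t * ‖z‖) / (1 + t * ‖z‖)))
      (Icc t₀ 1) := by
  have hmem : ∀ t ∈ Icc t₀ 1, t * ‖z‖ < 1 := fun t ht => by
    nlinarith [norm_nonneg z, ht.1, ht.2]
  have hball : ∀ t ∈ Icc t₀ 1, (t * z : ℂ) ∈ closedBall (0 : ℂ) 1 := fun t ht => by
    rw [mem_closedBall_zero_iff, norm_mul, Complex.norm_real,
      Real.norm_of_nonneg (ht₀.trans ht.1)]
    exact (hmem t ht).le
  have hballR : ∀ t ∈ Icc t₀ 1, (t * z : ℂ) ∈ ball (0 : ℂ) R := fun t ht =>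
    closedBall_subset_ball hR (hball t ht)
  have hu : ∀ t ∈ Icc t₀ 1, ∃ u', HasDerivAt (fun t : ℝ => height 0 (g (t * z))) u' t ∧
      u' ≤ ‖z‖ * (‖numer 0 (g (t * z))‖ * (‖deriv g (t * z)‖ /
        (2 * ‖g (t * z)‖ * ‖1 - g (t * z)‖))) := by
    intro t ht
    have hw0 := h0 _ (hballR t ht)
    have hw1 := h1 _ (hballR t ht)
    have hc0 := cusp_ne_zero hw0 hw1 0
    have hgd : HasDerivAt g (deriv g (t * z)) (t * z) :=
      (hg.differentiableAt (isOpen_ball.mem_nhds (hballR t ht))).hasDerivAt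
    have hray : HasDerivAt (fun s : ℝ => (s * z : ℂ)) (1 * z) t :=
      (Complex.ofRealCLM.hasDerivAt (x := t)).mul_const z
    have hf := ((hasDerivAt_cusp hw0 hw1 0).comp_of_eq _ hgd rfl).comp_of_eq t hray rfl
    refine ⟨_, ((hasDerivAt_log_norm hf hc0).div_const 2).const_add 6, ?_⟩
    have hinner := real_inner_le_norm (cusp 0 (g (t * z)))
      (cusp 0 (g (t * z)) * (numer 0 (g (t * z)) / (g (t * z) * (1 - g (t * z)))) *
        deriv g (t * z) * (1 * z))
    have hcpos : 0 < ‖cusp 0 (g (t * z))‖ := norm_pos_iff.2 hc0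
    have hw0' : 0 < ‖g (t * z)‖ := norm_pos_iff.2 hw0
    have hw1' : 0 < ‖1 - g (t * z)‖ := norm_pos_iff.2 (sub_ne_zero.2 hw1.symm)
    simp only [Function.comp]
    refine (div_le_div_of_nonneg_right (div_le_div_of_nonneg_right hinner (by positivity))
      two_pos.le).trans_eq ?_
    simp only [norm_mul, norm_div, norm_one]
    field_simp
  refine antitoneOn_of_deriv_nonpos (convex_Icc t₀ 1) ?_ ?_ ?_
  · intro t ht
    obtain ⟨u', hu', -⟩ := hu t ht
    have : 1 + t * ‖z‖ ≠ 0 := by have := ht₀.trans ht.1; positivity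
    exact (hu'.continuousAt.mul (by fun_prop (disch := assumption))).continuousWithinAt
  · rw [interior_Icc]
    intro t ht
    obtain ⟨u', hu', -⟩ := hu t (Ioo_subset_Icc_self ht)
    have : 1 + t * ‖z‖ ≠ 0 := by have := ht₀.trans ht.1.le; positivity
    exact (hu'.differentiableAt.mul
      (by fun_prop (disch := assumption))).differentiableWithinAt
  · rw [interior_Icc]
    intro t ht
    have htI := Ioo_subset_Icc_self ht
    have ht0 : 0 ≤ t := ht₀.trans ht.1.le
    obtain ⟨u', hu', hle⟩ := hu t htI
    have hpos : 0 < 1 + t * ‖z‖ := by positivity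
    have hpos' : 0 < 1 - t * ‖z‖ := by linarith [hmem t htI]
    have hid := (hasDerivAt_id t).mul_const ‖z‖
    have hv := hu'.mul ((hid.const_sub 1).div (hid.const_add 1) hpos.ne')
    rw [show deriv (fun t : ℝ => height 0 (g (t * z)) * ((1 - t * ‖z‖) / (1 + t * ‖z‖))) t = _
      from hv.deriv]
    have hmin : ∀ k, ‖side 0 (g (t * z))‖ ≤ ‖side k (g (t * z))‖ := by
      obtain ⟨ha, hb⟩ := hlarge t ht
      intro k
      fin_cases k <;> simp [side, ha, hb]
    have hd := dens_le_two hR hg h0 h1 (hball t htI) hmin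
    have hh := six_le_height (h0 _ (hballR t htI)) (h1 _ (hballR t htI)) hmin
    rw [dens, norm_mul, Complex.norm_real, Real.norm_of_nonneg ht0] at hd
    set B := ‖deriv g (t * z)‖ / (2 * ‖g (t * z)‖ * ‖1 - g (t * z)‖)
    set h := height 0 (g (t * z))
    have hd' : ‖numer 0 (g (t * z))‖ * B * (1 - (t * ‖z‖) ^ 2) ≤ 2 * h := by
      rw [div_mul_eq_mul_div, div_le_iff₀ (by linarith)] at hd
      linarith
    have hu2 : u' * ((1 - t * ‖z‖) * (1 + t * ‖z‖)) ≤ 2 * h * ‖z‖ := by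
      have e1 := mul_le_mul_of_nonneg_right hle (mul_pos hpos' hpos).le
      have e2 := mul_le_mul_of_nonneg_right hd' (norm_nonneg z)
      linarith
    have : u' * ((1 - t * ‖z‖) / (1 + t * ‖z‖)) + h * ((-(1 * ‖z‖) * (1 + t * ‖z‖) -
        (1 - t * ‖z‖) * (1 * ‖z‖)) / (1 + t * ‖z‖) ^ 2) =
        (u' * ((1 - t * ‖z‖) * (1 + t * ‖z‖)) - 2 * h * ‖z‖) / (1 + t * ‖z‖) ^ 2 := by
      field_simp
      ring
    exact this.trans_le (div_nonpos_of_nonpos_of_nonneg (by linarith) (by positivity))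

lemma log_norm_le {g : ℂ → ℂ} {R : ℝ} (hR : 1 < R) (hg : DifferentiableOn ℂ g (ball 0 R))
    (h0 : ∀ z ∈ ball (0 : ℂ) R, g z ≠ 0) (h1 : ∀ z ∈ ball (0 : ℂ) R, g z ≠ 1) {z : ℂ}
    (hz : ‖z‖ < 1) :
    Real.log ‖g z‖ ≤ (7 + max (Real.log ‖g 0‖) 0) * ((1 + ‖z‖) / (1 - ‖z‖)) := by
  set L := max (Real.log ‖g 0‖) 0 with hL
  have hL0 : 0 ≤ L := le_max_right _ _
  have hr := norm_nonneg z
  have hball : ∀ t ∈ Icc (0 : ℝ) 1, (t * z : ℂ) ∈ ball (0 : ℂ) R := fun t ht => by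
    rw [mem_ball_zero_iff, norm_mul, Complex.norm_real, Real.norm_of_nonneg ht.1]
    nlinarith [ht.1, ht.2]
  have hzR : z ∈ ball (0 : ℂ) R := mem_ball_zero_iff.2 (hz.trans hR)
  rcases le_total ‖g z‖ 2 with hsmall | hbig
  · have hlog : Real.log ‖g z‖ ≤ 1 :=
      (Real.log_le_log (norm_pos_iff.2 (h0 z hzR)) hsmall).trans log_two_le_one
    have : 1 ≤ (1 + ‖z‖) / (1 - ‖z‖) := by rw [le_div_iff₀ (by linarith)]; linarith
    nlinarith
  have hcont : ContinuousOn (fun t : ℝ => g (t * z)) (Icc 0 1) :=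
    hg.continuousOn.comp (by fun_prop) hball
  set T : Set ℝ := {t ∈ Icc (0 : ℝ) 1 | t ≤ 0 ∨ ‖g (t * z)‖ ≤ 1 ∨ ‖1 - g (t * z)‖ ≤ 1} with hT
  have hTc : IsCompact T := by
    refine isCompact_Icc.of_isClosed_subset ?_ (sep_subset _ _)
    have : T = {t ∈ Icc (0 : ℝ) 1 | t ≤ 0} ∪ ({t ∈ Icc (0 : ℝ) 1 | ‖g (t * z)‖ ≤ 1} ∪
        {t ∈ Icc (0 : ℝ) 1 | ‖1 - g (t * z)‖ ≤ 1}) := by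
      ext t; simp only [hT, mem_union, mem_ofPred_eq]; tauto
    rw [this]
    exact (isClosed_Icc.isClosed_le continuousOn_id continuousOn_const).union
      ((isClosed_Icc.isClosed_le hcont.norm continuousOn_const).union
      (isClosed_Icc.isClosed_le (continuousOn_const.sub hcont).norm continuousOn_const))
  obtain ⟨t₀, ht₀, hmax⟩ := hTc.exists_isGreatest ⟨0, by simp [hT]⟩
  have hanti := antitoneOn_height_mul hR hg h0 h1 hz ht₀.1.1 (t₀ := t₀) fun t ht => by
    have : t ∉ T := fun h => (hmax h).not_gt ht.1
    simp only [hT, mem_ofPred_eq, not_and, not_or, not_le] at this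
    have := this ⟨ht₀.1.1.trans ht.1.le, ht.2.le⟩
    exact ⟨this.2.1.le, this.2.2.le⟩
  have hheight : ∀ t ∈ Icc (0 : ℝ) 1, height 0 (g (t * z)) =
      6 + (Real.log ‖g (t * z)‖ + Real.log ‖1 - g (t * z)‖) / 2 := fun t ht => by
    rw [height, log_norm_cusp (h0 _ (hball t ht)) (h1 _ (hball t ht))]
    simp [side]
  have hstart : height 0 (g (t₀ * z)) ≤ 7 + L := by
    rw [hheight t₀ ht₀.1]
    have : Real.log ‖g (t₀ * z)‖ ≤ L ∨ ‖g (t₀ * z)‖ ≤ 1 ∨ ‖1 - g (t₀ * z)‖ ≤ 1 := by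
      refine ht₀.2.imp_left fun h => ?_
      rw [le_antisymm h ht₀.1.1, Complex.ofReal_zero, zero_mul]
      exact le_max_left _ _
    linarith [log_norm_add_log_norm_le hL0 this]
  have hend : height 0 (g z) * ((1 - ‖z‖) / (1 + ‖z‖)) ≤ 7 + L := by
    have hle := hanti (left_mem_Icc.2 ht₀.1.2) (right_mem_Icc.2 ht₀.1.2) ht₀.1.2
    simp only [Complex.ofReal_one, one_mul] at hle
    refine hle.trans ?_
    have hp : 0 ≤ t₀ * ‖z‖ := mul_nonneg ht₀.1.1 hr
    have hp' : t₀ * ‖z‖ ≤ 1 := by nlinarith [ht₀.1.2]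
    have hs0 : 0 ≤ (1 - t₀ * ‖z‖) / (1 + t₀ * ‖z‖) := div_nonneg (by linarith) (by linarith)
    have hs1 : (1 - t₀ * ‖z‖) / (1 + t₀ * ‖z‖) ≤ 1 := by
      rw [div_le_one (by linarith)]; linarith
    exact (mul_le_mul_of_nonneg_right hstart hs0).trans (mul_le_of_le_one_right (by linarith) hs1)
  have hlog : Real.log ‖g z‖ ≤ height 0 (g z) := by
    have h := hheight 1 (by simp)
    simp only [Complex.ofReal_one, one_mul] at h
    have t1 : ‖g z‖ ≤ 1 + ‖1 - g z‖ := by simpa using norm_sub_le (1 : ℂ) (1 - g z)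
    have : Real.log ‖g z‖ ≤ Real.log (2 * ‖1 - g z‖) :=
      Real.log_le_log (by linarith) (by linarith)
    rw [Real.log_mul two_ne_zero (by linarith)] at this
    linarith [log_two_le_one]
  refine hlog.trans ?_
  rw [mul_div_assoc', div_le_iff₀ (by linarith)] at hend
  rw [mul_div_assoc', le_div_iff₀ (by linarith)]
  linarith

end ThricePuncturedSphere

/-- Quantitative Schottky-type theorem: if `g` is analytic on the unit disc and omits
the values `0` and `1`, then `log |g(z)| ≤ (7 + log⁺|g(0)|)·(1+|z|)/(1-|z|)`. -/
theorem schottky_bound (g : ℂ → ℂ)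
    (hg : DifferentiableOn ℂ g (ball 0 1))
    (h0 : ∀ z ∈ ball (0 : ℂ) 1, g z ≠ 0)
    (h1 : ∀ z ∈ ball (0 : ℂ) 1, g z ≠ 1) :
    ∀ z ∈ ball (0 : ℂ) 1,
      Real.log ‖g z‖ ≤ (7 + max (Real.log ‖g 0‖) 0) * ((1 + ‖z‖) / (1 - ‖z‖)) := by
  intro z hz
  have hz1 : ‖z‖ < 1 := mem_ball_zero_iff.1 hz
  have hdilate : ∀ᶠ s : ℝ in 𝓝[<] 1, Real.log ‖g z‖ ≤
      (7 + max (Real.log ‖g 0‖) 0) * ((1 + ‖z‖ / s) / (1 - ‖z‖ / s)) := by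
    filter_upwards [Ioo_mem_nhdsLT hz1] with s hs
    have hs0 : 0 < s := (norm_nonneg z).trans_lt hs.1
    have hmaps : MapsTo (fun x : ℂ => (s : ℂ) * x) (ball 0 s⁻¹) (ball 0 1) := fun x hx => by
      rw [mem_ball_zero_iff] at hx ⊢
      rw [norm_mul, Complex.norm_real, Real.norm_of_nonneg hs0.le]
      calc s * ‖x‖ < s * s⁻¹ := by gcongr
        _ = 1 := mul_inv_cancel₀ hs0.ne'
    have hnorm : ‖z / (s : ℂ)‖ = ‖z‖ / s := by
      rw [norm_div, Complex.norm_real, Real.norm_of_nonneg hs0.le]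
    have hsC : (s : ℂ) ≠ 0 := by exact_mod_cast hs0.ne'
    have := ThricePuncturedSphere.log_norm_le (g := fun x => g (s * x)) (z := z / s)
      ((one_lt_inv₀ hs0).2 hs.2) (hg.comp (by fun_prop) hmaps) (fun x hx => h0 _ (hmaps hx))
      (fun x hx => h1 _ (hmaps hx)) (by rw [hnorm, div_lt_one hs0]; exact hs.1)
    simpa only [hnorm, mul_zero, mul_div_cancel₀ z hsC] using this
  have hlim : Tendsto (fun s : ℝ => (7 + max (Real.log ‖g 0‖) 0) *
      ((1 + ‖z‖ / s) / (1 - ‖z‖ / s))) (𝓝[<] 1)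
      (𝓝 ((7 + max (Real.log ‖g 0‖) 0) * ((1 + ‖z‖ / 1) / (1 - ‖z‖ / 1)))) := by
    have hne : 1 - ‖z‖ / 1 ≠ 0 := by rw [div_one]; linarith
    have : ContinuousAt (fun s : ℝ => (7 + max (Real.log ‖g 0‖) 0) *
        ((1 + ‖z‖ / s) / (1 - ‖z‖ / s))) 1 := by
      have hdiv : ContinuousAt (fun s : ℝ => ‖z‖ / s) 1 :=
        continuousAt_const.div continuousAt_id one_ne_zero
      exact continuousAt_const.mul
        ((continuousAt_const.add hdiv).div (continuousAt_const.sub hdiv) hne)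
    exact this.tendsto.mono_left nhdsWithin_le_nhds
  simpa only [div_one] using ge_of_tendsto hlim hdilate
end

section
/- Let Ω be a domain in Ĉ, let E be a connected component of Ĉ \ Ω, and let F be a nonempty closed subset of Ĉ \ Ω with E ∩ F = ∅. Then there exists a simple closed curve contained in Ω that separates E and F, i.e., E and F lie in different connected components of the complement of the curve. -/
open Metric Set OnePoint

/-- A domain in the Riemann sphere: a nonempty open connected set. -/
def IsSphereDomain (Ω : Set (OnePoint ℂ)) : Prop :=
  IsOpen Ω ∧ IsConnected Ω

namespace SquareGrid

/-- Two points of `ℤ × ℤ` are adjacent when they are at distance one. Points of `ℤ × ℤ` serve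
both as lattice points and as names of the unit squares of which they are the lower left corner. -/
def Adj (a b : ℤ × ℤ) : Prop := (a.1 - b.1).natAbs + (a.2 - b.2).natAbs = 1

lemma Adj.symm {a b : ℤ × ℤ} (h : Adj a b) : Adj b a := by
  unfold Adj at *; omega

/-- One of the two squares having the lattice edge `p q` as a side. -/
def upperCell (p q : ℤ × ℤ) : ℤ × ℤ := (min p.1 q.1, min p.2 q.2)

/-- The other square having the lattice edge `p q` as a side. -/
def lowerCell (p q : ℤ × ℤ) : ℤ × ℤ := (max p.1 q.1 - 1, max p.2 q.2 - 1)

/-- The lattice edge `p q` is the common side of the squares `a` and `b`. -/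
def Separates (p q a b : ℤ × ℤ) : Prop :=
  (a = upperCell p q ∧ b = lowerCell p q) ∨ (b = upperCell p q ∧ a = lowerCell p q)

lemma adj_upperCell_lowerCell {p q : ℤ × ℤ} (h : Adj p q) :
    Adj (upperCell p q) (lowerCell p q) := by
  unfold Adj upperCell lowerCell at *; dsimp only; omega

/-- Adjacent lattice points whose edge lies on the boundary of the set `D` of squares. -/
def BoundaryEdge (D : Set (ℤ × ℤ)) (p q : ℤ × ℤ) : Prop :=
  Adj p q ∧ ¬(upperCell p q ∈ D ↔ lowerCell p q ∈ D)

lemma adj_cases {p q : ℤ × ℤ} (h : Adj p q) :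
    q = (p.1 + 1, p.2) ∨ q = (p.1 - 1, p.2) ∨ q = (p.1, p.2 + 1) ∨ q = (p.1, p.2 - 1) := by
  obtain ⟨p1, p2⟩ := p
  obtain ⟨q1, q2⟩ := q
  simp only [Adj, Prod.mk.injEq] at *
  omega

lemma exists_separates {a b : ℤ × ℤ} (h : Adj a b) :
    ∃ p q, Adj p q ∧ Separates p q a b := by
  obtain ⟨a1, a2⟩ := a
  rcases adj_cases h with rfl | rfl | rfl | rfl
  · refine ⟨(a1 + 1, a2), (a1 + 1, a2 + 1), ?_, .inr ?_⟩ <;>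
      simp only [Adj, upperCell, lowerCell, Prod.mk.injEq] <;> omega
  · refine ⟨(a1, a2), (a1, a2 + 1), ?_, .inl ?_⟩ <;>
      simp only [Adj, upperCell, lowerCell, Prod.mk.injEq] <;> omega
  · refine ⟨(a1, a2 + 1), (a1 + 1, a2 + 1), ?_, .inr ?_⟩ <;>
      simp only [Adj, upperCell, lowerCell, Prod.mk.injEq] <;> omega
  · refine ⟨(a1, a2), (a1 + 1, a2), ?_, .inl ?_⟩ <;>
      simp only [Adj, upperCell, lowerCell, Prod.mk.injEq] <;> omega

lemma BoundaryEdge.exists_next {D : Set (ℤ × ℤ)} {p q : ℤ × ℤ} (h : BoundaryEdge D p q) :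
    ∃ r, r ≠ p ∧ BoundaryEdge D q r := by
  have key : ∀ x : ℤ × ℤ, BoundaryEdge D q x → ∃ r, r ≠ x ∧ BoundaryEdge D q r := by
    obtain ⟨q1, q2⟩ := q
    have e1 : BoundaryEdge D (q1, q2) (q1 + 1, q2) ↔ ¬((q1, q2) ∈ D ↔ (q1, q2 - 1) ∈ D) := by
      simp [BoundaryEdge, Adj, upperCell, lowerCell]
    have e2 : BoundaryEdge D (q1, q2) (q1 - 1, q2) ↔
        ¬((q1 - 1, q2) ∈ D ↔ (q1 - 1, q2 - 1) ∈ D) := by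
      simp [BoundaryEdge, Adj, upperCell, lowerCell]
    have e3 : BoundaryEdge D (q1, q2) (q1, q2 + 1) ↔ ¬((q1, q2) ∈ D ↔ (q1 - 1, q2) ∈ D) := by
      simp [BoundaryEdge, Adj, upperCell, lowerCell]
    have e4 : BoundaryEdge D (q1, q2) (q1, q2 - 1) ↔
        ¬((q1, q2 - 1) ∈ D ↔ (q1 - 1, q2 - 1) ∈ D) := by
      simp [BoundaryEdge, Adj, upperCell, lowerCell]
    have n1 : (q1 + 1, q2) ≠ (q1 - 1, q2) := by simp; omega
    have n2 : (q1 + 1, q2) ≠ (q1, q2 + 1) := by simp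
    have n3 : (q1 + 1, q2) ≠ (q1, q2 - 1) := by simp
    have n4 : (q1 - 1, q2) ≠ (q1, q2 + 1) := by simp
    have n5 : (q1 - 1, q2) ≠ (q1, q2 - 1) := by simp
    have n6 : (q1, q2 + 1) ≠ (q1, q2 - 1) := by simp; omega
    intro x hx
    by_contra! hcon
    have c1 := fun n ↦ not_not.1 (e1.not.1 (hcon (q1 + 1, q2) n))
    have c2 := fun n ↦ not_not.1 (e2.not.1 (hcon (q1 - 1, q2) n))
    have c3 := fun n ↦ not_not.1 (e3.not.1 (hcon (q1, q2 + 1) n))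
    have c4 := fun n ↦ not_not.1 (e4.not.1 (hcon (q1, q2 - 1) n))
    rcases adj_cases hx.1 with rfl | rfl | rfl | rfl
    · exact e1.1 hx ((c3 n2.symm).trans ((c2 n1.symm).trans (c4 n3.symm).symm))
    · exact e2.1 hx ((c3 n4.symm).symm.trans ((c1 n1).trans (c4 n5.symm)))
    · exact e3.1 hx ((c1 n2).trans ((c4 n6.symm).trans (c2 n4).symm))
    · exact e4.1 hx ((c1 n3).symm.trans ((c3 n6).trans (c2 n5)))
  refine key p ⟨h.1.symm, ?_⟩
  have := h.2
  unfold upperCell lowerCell at *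
  rwa [min_comm q.1, min_comm q.2, max_comm q.1, max_comm q.2]

/-- The signed contribution of the lattice edge `p q` to the winding number around the
square `c`, computed along a horizontal ray from `c` to the left. -/
def crossing (c p q : ℤ × ℤ) : ℤ := if p.1 ≤ c.1 ∧ min p.2 q.2 = c.2 then q.2 - p.2 else 0

lemma crossing_right (c : ℤ × ℤ) {p q : ℤ × ℤ} (h : Adj p q) :
    crossing (c.1 + 1, c.2) p q - crossing c p q =
      if p.1 = c.1 + 1 ∧ q.1 = c.1 + 1 ∧ min p.2 q.2 = c.2 then q.2 - p.2 else 0 := by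
  unfold crossing Adj at *
  dsimp only
  split_ifs <;> omega

lemma crossing_up (c : ℤ × ℤ) {p q : ℤ × ℤ} (h : Adj p q) :
    crossing (c.1, c.2 + 1) p q - crossing c p q =
      (if min p.1 q.1 = c.1 ∧ p.2 = c.2 + 1 ∧ q.2 = c.2 + 1 then p.1 - q.1 else 0) +
      ((if p.1 ≤ c.1 ∧ p.2 = c.2 + 1 then 1 else 0) -
        (if q.1 ≤ c.1 ∧ q.2 = c.2 + 1 then 1 else 0)) := by
  unfold crossing Adj at *
  dsimp only
  split_ifs <;> omega

/-- A closed path of length `n` in the lattice, extended `n`-periodically to all integers, that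
visits every lattice point at most once per period. -/
structure IsSimpleLoop (f : ℤ → ℤ × ℤ) (n : ℕ) : Prop where
  three_le : 3 ≤ n
  periodic : ∀ k, f (k + n) = f k
  adj : ∀ k, Adj (f k) (f (k + 1))
  dvd_of_eq : ∀ k l, f k = f l → (n : ℤ) ∣ k - l

/-- The winding number of the closed lattice path `f` of length `n` around the square `c`. -/
def winding (f : ℤ → ℤ × ℤ) (n : ℕ) (c : ℤ × ℤ) : ℤ :=
  ∑ k ∈ Finset.range n, crossing c (f k) (f (k + 1))

lemma Separates.symm {p q a b : ℤ × ℤ} (h : Separates p q a b) : Separates p q b a :=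
  Or.symm h

lemma Separates.add_eq {p q a b : ℤ × ℤ} (h : Separates p q a b) :
    p.1 + q.1 = a.1 + b.1 + 1 ∧ p.2 + q.2 = a.2 + b.2 + 1 := by
  rcases h with ⟨rfl, rfl⟩ | ⟨rfl, rfl⟩ <;> simp only [upperCell, lowerCell] <;> omega

lemma Separates.eq_or_eq {p q p' q' a b : ℤ × ℤ} (h : Separates p q a b)
    (h' : Separates p' q' a b) (hpq : Adj p q) (hpq' : Adj p' q') :
    (p = p' ∧ q = q') ∨ (p = q' ∧ q = p') := by
  have h1 := h.add_eq
  have h2 := h'.add_eq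
  clear h h'
  simp only [Adj, Prod.ext_iff] at *
  omega

lemma exists_winding_sub_winding {f : ℤ → ℤ × ℤ} {n : ℕ} (hf : IsSimpleLoop f n)
    {a b : ℤ × ℤ} (hab : Adj a b) :
    ∃ s : ℤ → ℤ, winding f n a - winding f n b = ∑ k ∈ Finset.range n, s k ∧
      ∀ k, s k ≠ 0 ↔ Separates (f k) (f (k + 1)) a b := by
  have right : ∀ c : ℤ × ℤ, ∃ s : ℤ → ℤ,
      winding f n (c.1 + 1, c.2) - winding f n c = ∑ k ∈ Finset.range n, s k ∧
      ∀ k, s k ≠ 0 ↔ Separates (f k) (f (k + 1)) (c.1 + 1, c.2) c := by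
    intro c
    refine ⟨fun k ↦ if (f k).1 = c.1 + 1 ∧ (f (k + 1)).1 = c.1 + 1 ∧
      min (f k).2 (f (k + 1)).2 = c.2 then (f (k + 1)).2 - (f k).2 else 0, ?_, fun k ↦ ?_⟩
    · rw [winding, winding, ← Finset.sum_sub_distrib]
      exact Finset.sum_congr rfl fun k _ ↦ crossing_right c (hf.adj k)
    · have := hf.adj k
      obtain ⟨c1, c2⟩ := c
      simp only [Separates, upperCell, lowerCell, Adj, Prod.ext_iff] at *
      split_ifs <;> omega
  have up : ∀ c : ℤ × ℤ, ∃ s : ℤ → ℤ,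
      winding f n (c.1, c.2 + 1) - winding f n c = ∑ k ∈ Finset.range n, s k ∧
      ∀ k, s k ≠ 0 ↔ Separates (f k) (f (k + 1)) (c.1, c.2 + 1) c := by
    intro c
    refine ⟨fun k ↦ if min (f k).1 (f (k + 1)).1 = c.1 ∧ (f k).2 = c.2 + 1 ∧
      (f (k + 1)).2 = c.2 + 1 then (f k).1 - (f (k + 1)).1 else 0, ?_, fun k ↦ ?_⟩
    · rw [winding, winding, ← Finset.sum_sub_distrib]
      rw [Finset.sum_congr rfl fun (k : ℕ) _ ↦ crossing_up c (hf.adj k), Finset.sum_add_distrib,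
        add_eq_left]
      have := Finset.sum_range_sub' (fun k : ℕ ↦
        if (f k).1 ≤ c.1 ∧ (f k).2 = c.2 + 1 then (1 : ℤ) else 0) n
      have h0 : f n = f 0 := by simpa using hf.periodic 0
      push_cast at this
      rw [this, h0, sub_self]
    · have := hf.adj k
      obtain ⟨c1, c2⟩ := c
      simp only [Separates, upperCell, lowerCell, Adj, Prod.ext_iff] at *
      split_ifs <;> omega
  have flip : ∀ a b : ℤ × ℤ, (∃ s : ℤ → ℤ,
      winding f n a - winding f n b = ∑ k ∈ Finset.range n, s k ∧
      ∀ k, s k ≠ 0 ↔ Separates (f k) (f (k + 1)) a b) → ∃ s : ℤ → ℤ,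
      winding f n b - winding f n a = ∑ k ∈ Finset.range n, s k ∧
      ∀ k, s k ≠ 0 ↔ Separates (f k) (f (k + 1)) b a := by
    rintro a b ⟨s, hs, hs'⟩
    refine ⟨fun k ↦ -s k, by rw [Finset.sum_neg_distrib, ← hs, neg_sub], fun k ↦ ?_⟩
    rw [neg_ne_zero, hs' k]
    exact ⟨Separates.symm, Separates.symm⟩
  rcases adj_cases hab.symm with rfl | rfl | rfl | rfl
  · exact right b
  · apply flip
    simpa using right (b.1 - 1, b.2)
  · exact up b
  · apply flip
    simpa using up (b.1, b.2 - 1)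

lemma winding_eq_of_forall_not_separates {f : ℤ → ℤ × ℤ} {n : ℕ} (hf : IsSimpleLoop f n)
    {a b : ℤ × ℤ} (hab : Adj a b) (h : ∀ k, ¬Separates (f k) (f (k + 1)) a b) :
    winding f n a = winding f n b := by
  obtain ⟨s, hs, hs'⟩ := exists_winding_sub_winding hf hab
  rw [← sub_eq_zero, hs]
  exact Finset.sum_eq_zero fun k _ ↦ not_not.1 ((hs' k).not.2 (h k))

lemma IsSimpleLoop.dvd_of_separates {f : ℤ → ℤ × ℤ} {n : ℕ} (hf : IsSimpleLoop f n) {k l : ℤ}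
    (h : (f k = f l ∧ f (k + 1) = f (l + 1)) ∨ (f k = f (l + 1) ∧ f (k + 1) = f l)) :
    (n : ℤ) ∣ k - l := by
  rcases h with h | h
  · exact hf.dvd_of_eq _ _ h.1
  · have h1 := hf.dvd_of_eq _ _ h.1
    have h2 := hf.dvd_of_eq _ _ h.2
    have h3 : (n : ℤ) ∣ 2 := by
      have := dvd_sub h2 h1
      ring_nf at this
      exact this
    have := Int.le_of_dvd (by norm_num) h3
    have := hf.three_le
    omega

lemma winding_ne_of_separates {f : ℤ → ℤ × ℤ} {n : ℕ} (hf : IsSimpleLoop f n)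
    {a b : ℤ × ℤ} (hab : Adj a b) {k : ℕ} (hk : k < n)
    (h : Separates (f k) (f (k + 1)) a b) : winding f n a ≠ winding f n b := by
  obtain ⟨s, hs, hs'⟩ := exists_winding_sub_winding hf hab
  rw [← sub_ne_zero, hs, Finset.sum_eq_single k]
  · exact (hs' k).2 h
  · intro l hl hlk
    by_contra hne
    have hd := hf.dvd_of_separates (((hs' l).1 hne).eq_or_eq h (hf.adj l) (hf.adj k))
    rw [Finset.mem_range] at hl
    have := Int.eq_zero_of_abs_lt_dvd hd (by rw [abs_lt]; omega)
    omega
  · simp [hk]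

lemma exists_isSimpleLoop {r : ℤ × ℤ → ℤ × ℤ → Prop} (hadj : ∀ p q, r p q → Adj p q)
    (hnext : ∀ p q, r p q → ∃ t, t ≠ p ∧ r q t) (hfin : {p | ∃ q, r p q}.Finite)
    (hne : ∃ p q, r p q) :
    ∃ f n, IsSimpleLoop f n ∧ ∀ k, r (f k) (f (k + 1)) := by
  choose! t ht using hnext
  obtain ⟨p, q, hpq⟩ := hne
  let s : ℕ → (ℤ × ℤ) × (ℤ × ℤ) := fun k ↦ (fun x ↦ (x.2, t x.1 x.2))^[k] (p, q)
  have hs0 : ∀ k, s (k + 1) = ((s k).2, t (s k).1 (s k).2) := fun k ↦ by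
    simp only [s, Function.iterate_succ_apply']
  have hs : ∀ k, r (s k).1 (s k).2 := by
    intro k
    induction k with
    | zero => exact hpq
    | succ k ih => rw [hs0]; exact (ht _ _ ih).2
  obtain ⟨v, hv⟩ : ∃ v : ℕ → ℤ × ℤ, v = fun k ↦ (s k).1 := ⟨_, rfl⟩
  have hv1 : ∀ k, (s k).2 = v (k + 1) := fun k ↦ by rw [hv]; dsimp only; rw [hs0]
  have hvr : ∀ k, r (v k) (v (k + 1)) := fun k ↦ by
    have := hs k
    rw [hv1] at this
    rwa [hv] at this ⊢
  have hv2 : ∀ k, v (k + 2) ≠ v k := fun k ↦ by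
    rw [← hv1 (k + 1), hs0]
    have := (ht _ _ (hs k)).1
    rw [hv]
    exact this
  have hrep : ∃ j, ∃ i < j, v i = v j := by
    obtain ⟨i, j, hij, h⟩ :=
      have := hfin.to_subtype
      Finite.exists_ne_map_eq_of_infinite fun k ↦ (⟨v k, _, hvr k⟩ : {p | ∃ q, r p q})
    rw [Subtype.mk.injEq] at h
    rcases hij.lt_or_gt with hij | hij
    exacts [⟨j, i, hij, h⟩, ⟨i, j, hij, h.symm⟩]
  classical
  obtain ⟨i, hij, hvij⟩ := Nat.find_spec hrep
  have hmin := fun {m} ↦ Nat.find_min hrep (m := m)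
  generalize Nat.find hrep = j at *
  obtain ⟨n, rfl⟩ := Nat.exists_eq_add_of_lt hij
  have hinj : ∀ k < n + 1, ∀ l < n + 1, v (i + k) = v (i + l) → k = l := by
    intro k hk l hl h
    rcases lt_trichotomy k l with hkl | hkl | hkl
    · exact (hmin (m := i + l) (by omega) ⟨i + k, by omega, h⟩).elim
    · exact hkl
    · exact (hmin (m := i + k) (by omega) ⟨i + l, by omega, h.symm⟩).elim
  have hn3 : 3 ≤ n + 1 := by
    rcases n with _ | _ | n
    · have := hadj _ _ (hvr i)
      rw [hvij] at this
      simp [Adj] at this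
    · exact (hv2 i hvij.symm).elim
    · omega
  have hmodlt : ∀ k : ℤ, (k % (n + 1 : ℕ)).toNat < n + 1 := fun k ↦ by
    have := Int.emod_lt_of_pos k (b := (n + 1 : ℕ)) (by omega)
    have := Int.emod_nonneg k (b := (n + 1 : ℕ)) (by omega)
    omega
  have hstep : ∀ k : ℤ, v (i + ((k + 1) % (n + 1 : ℕ)).toNat) =
      v (i + (k % (n + 1 : ℕ)).toNat + 1) := fun k ↦ by
    have h1 := Int.emod_lt_of_pos k (b := (n + 1 : ℕ)) (by omega)
    have h2 := Int.emod_nonneg k (b := (n + 1 : ℕ)) (by omega)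
    by_cases h : k % (n + 1 : ℕ) = n
    · have : (k + 1) % (n + 1 : ℕ) = 0 := by
        rw [Int.add_emod, h]
        simp
      rw [this, h]
      simpa [add_assoc] using hvij
    · have : (k + 1) % (n + 1 : ℕ) = k % (n + 1 : ℕ) + 1 := by
        rw [← Int.emod_add_emod]
        exact Int.emod_eq_of_lt (by omega) (by omega)
      rw [this, Int.toNat_add h2 (by norm_num)]
      rfl
  have hr : ∀ k : ℤ, r (v (i + (k % (n + 1 : ℕ)).toNat))
      (v (i + ((k + 1) % (n + 1 : ℕ)).toNat)) := fun k ↦ by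
    rw [hstep]; exact hvr _
  refine ⟨fun k ↦ v (i + (k % (n + 1 : ℕ)).toNat), n + 1, ⟨hn3, fun k ↦ ?_,
    fun k ↦ hadj _ _ (hr k), fun k l h ↦ ?_⟩, hr⟩
  · simp
  · have := hinj _ (hmodlt k) _ (hmodlt l) h
    have h2 := Int.emod_nonneg k (b := (n + 1 : ℕ)) (by omega)
    have h3 := Int.emod_nonneg l (b := (n + 1 : ℕ)) (by omega)
    exact Int.ModEq.dvd (show l % _ = k % _ by omega)

/-- Two squares of `S` can be joined by a chain of adjacent squares of `S`. -/
def JoinedIn (S : Set (ℤ × ℤ)) : ℤ × ℤ → ℤ × ℤ → Prop :=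
  Relation.ReflTransGen fun a b ↦ Adj a b ∧ a ∈ S ∧ b ∈ S

instance (S : Set (ℤ × ℤ)) : Std.Symm fun a b : ℤ × ℤ ↦ Adj a b ∧ a ∈ S ∧ b ∈ S :=
  ⟨fun _ _ h ↦ ⟨h.1.symm, h.2.2, h.2.1⟩⟩

lemma JoinedIn.symm {S : Set (ℤ × ℤ)} {a b : ℤ × ℤ} (h : JoinedIn S a b) : JoinedIn S b a :=
  Relation.ReflTransGen.stdSymm.symm _ _ h

lemma JoinedIn.apply_eq {α : Type*} {S : Set (ℤ × ℤ)} {a b : ℤ × ℤ} (h : JoinedIn S a b)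
    {w : ℤ × ℤ → α} (hw : ∀ a ∈ S, ∀ b ∈ S, Adj a b → w a = w b) : w a = w b := by
  induction h with
  | refl => rfl
  | tail _ h ih => exact ih.trans (hw _ h.2.1 _ h.2.2 h.1)

lemma BoundaryEdge.of_separates {D : Set (ℤ × ℤ)} {p q a b : ℤ × ℤ} (hpq : Adj p q)
    (h : Separates p q a b) (ha : a ∈ D) (hb : b ∉ D) : BoundaryEdge D p q := by
  refine ⟨hpq, ?_⟩
  rcases h with ⟨rfl, rfl⟩ | ⟨rfl, rfl⟩ <;> tauto

/-- The boundary of a finite connected set of squares whose complement is connected is a single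
simple closed lattice path. -/
theorem exists_boundary_loop {D : Set (ℤ × ℤ)} (hfin : D.Finite) (hne : D.Nonempty)
    (hD : ∀ a ∈ D, ∀ b ∈ D, JoinedIn D a b) (hDc : ∀ a ∉ D, ∀ b ∉ D, JoinedIn Dᶜ a b) :
    ∃ f n, IsSimpleLoop f n ∧ (∀ k, BoundaryEdge D (f k) (f (k + 1))) ∧
      ∀ a ∈ D, ∀ b ∉ D, Adj a b → ∃ k, Separates (f k) (f (k + 1)) a b := by
  have hBfin : {p | ∃ q, BoundaryEdge D p q}.Finite := by
    refine ((hfin.prod (Set.finite_Icc (-1 : ℤ × ℤ) 1)).image fun x ↦ x.1 + x.2).subset ?_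
    have h : ∀ p : ℤ × ℤ, (∃ a ∈ D, (a.1 - p.1).natAbs ≤ 1 ∧ (a.2 - p.2).natAbs ≤ 1) →
        p ∈ (fun x : (ℤ × ℤ) × (ℤ × ℤ) ↦ x.1 + x.2) '' D ×ˢ Icc (-1) 1 := by
      rintro p ⟨a, ha, h1, h2⟩
      refine ⟨(a, p - a), ⟨ha, ⟨?_, ?_⟩, ⟨?_, ?_⟩⟩, by simp⟩ <;> simp <;> omega
    rintro p ⟨q, hpq, hpD⟩
    apply h
    have hu : (p.1 - (upperCell p q).1).natAbs ≤ 1 ∧ (p.2 - (upperCell p q).2).natAbs ≤ 1 := by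
      unfold Adj upperCell at *; dsimp only; omega
    have hl : (p.1 - (lowerCell p q).1).natAbs ≤ 1 ∧ (p.2 - (lowerCell p q).2).natAbs ≤ 1 := by
      unfold Adj lowerCell at *; dsimp only; omega
    by_cases hu' : upperCell p q ∈ D
    · exact ⟨_, hu', by omega⟩
    · exact ⟨_, by_contra fun hl' ↦ hpD (by tauto), by omega⟩
  have hBne : ∃ p q, BoundaryEdge D p q := by
    obtain ⟨a, ha, hmax⟩ := hfin.exists_maximalFor Prod.fst D hne
    have hb : (a.1 + 1, a.2) ∉ D := fun hb ↦ by
      have := hmax hb (by simp)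
      simp at this
    obtain ⟨p, q, hpq, hsep⟩ := exists_separates (a := a) (b := (a.1 + 1, a.2)) (by simp [Adj])
    exact ⟨p, q, .of_separates hpq hsep ha hb⟩
  obtain ⟨f, n, hf, hfD⟩ := exists_isSimpleLoop (r := BoundaryEdge D) (fun _ _ h ↦ h.1)
    (fun _ _ h ↦ h.exists_next) hBfin hBne
  refine ⟨f, n, hf, hfD, ?_⟩
  have hw : ∀ a b, Adj a b → (a ∈ D ↔ b ∈ D) → winding f n a = winding f n b := by
    intro a b hab h
    refine winding_eq_of_forall_not_separates hf hab fun k hk ↦ (hfD k).2 ?_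
    rcases hk with ⟨rfl, rfl⟩ | ⟨rfl, rfl⟩
    exacts [h, h.symm]
  have h1 : ∀ a ∈ D, ∀ b ∈ D, winding f n a = winding f n b := fun a ha b hb ↦
    (hD a ha b hb).apply_eq fun a ha b hb hab ↦ hw a b hab (by tauto)
  have h2 : ∀ a ∉ D, ∀ b ∉ D, winding f n a = winding f n b := fun a ha b hb ↦
    (hDc a ha b hb).apply_eq fun a ha b hb hab ↦ hw a b hab (by
      rw [mem_compl_iff] at ha hb; tauto)
  have h3 : ∃ a ∈ D, ∃ b ∉ D, winding f n a ≠ winding f n b := by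
    have hk := hfD 0
    have hsep : winding f n (upperCell (f 0) (f (0 + 1))) ≠
        winding f n (lowerCell (f 0) (f (0 + 1))) :=
      winding_ne_of_separates hf (adj_upperCell_lowerCell hk.1) (k := 0)
        (by have := hf.three_le; omega) (.inl ⟨rfl, rfl⟩)
    by_cases hu : upperCell (f 0) (f (0 + 1)) ∈ D
    · exact ⟨_, hu, _, fun hl ↦ hk.2 (by tauto), hsep⟩
    · exact ⟨_, by_contra fun hl ↦ hk.2 (by tauto), _, hu, hsep.symm⟩
  obtain ⟨a₀, ha₀, b₀, hb₀, hab₀⟩ := h3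
  intro a ha b hb hab
  by_contra! hcon
  refine hab₀ ?_
  rw [h1 a₀ ha₀ a ha, h2 b₀ hb₀ b hb]
  exact winding_eq_of_forall_not_separates hf hab hcon

/-- The closed unit square with lower left corner `c`. -/
def cell (c : ℤ × ℤ) : Set ℂ := Icc (c.1 : ℝ) (c.1 + 1) ×ℂ Icc (c.2 : ℝ) (c.2 + 1)

lemma mem_cell {c : ℤ × ℤ} {z : ℂ} :
    z ∈ cell c ↔ (c.1 ≤ z.re ∧ z.re ≤ c.1 + 1) ∧ (c.2 ≤ z.im ∧ z.im ≤ c.2 + 1) := Iff.rfl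

lemma isClosed_cell (c : ℤ × ℤ) : IsClosed (cell c) := isClosed_Icc.reProdIm isClosed_Icc

lemma convex_cell (c : ℤ × ℤ) : Convex ℝ (cell c) :=
  ((convex_Icc (c.1 : ℝ) (c.1 + 1)).linear_preimage Complex.reLm).inter
    ((convex_Icc (c.2 : ℝ) (c.2 + 1)).linear_preimage Complex.imLm)

lemma mem_cell_floor (z : ℂ) : z ∈ cell (⌊z.re⌋, ⌊z.im⌋) :=
  ⟨⟨Int.floor_le _, (Int.lt_floor_add_one _).le⟩, ⟨Int.floor_le _, (Int.lt_floor_add_one _).le⟩⟩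

lemma dist_le_of_mem_cell {c : ℤ × ℤ} {z w : ℂ} (hz : z ∈ cell c) (hw : w ∈ cell c) :
    dist z w ≤ 2 := by
  rw [mem_cell] at hz hw
  rw [dist_eq_norm]
  refine (Complex.norm_le_abs_re_add_abs_im _).trans ?_
  have h1 : |(z - w).re| ≤ 1 := by rw [Complex.sub_re, abs_le]; constructor <;> linarith
  have h2 : |(z - w).im| ≤ 1 := by rw [Complex.sub_im, abs_le]; constructor <;> linarith
  linarith

lemma locallyFinite_cell : LocallyFinite cell := by
  intro z
  refine ⟨ball z 1, ball_mem_nhds z one_pos, ?_⟩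
  refine ((Set.finite_Icc (⌊z.re⌋ - 2) (⌊z.re⌋ + 2)).prod
    (Set.finite_Icc (⌊z.im⌋ - 2) (⌊z.im⌋ + 2))).subset ?_
  rintro c ⟨w, hw, hwz⟩
  rw [mem_cell] at hw
  rw [mem_ball, dist_eq_norm] at hwz
  have h1 := abs_lt.1 ((Complex.abs_re_le_norm (w - z)).trans_lt hwz)
  have h2 := abs_lt.1 ((Complex.abs_im_le_norm (w - z)).trans_lt hwz)
  rw [Complex.sub_re] at h1
  rw [Complex.sub_im] at h2
  have h3 := Int.floor_le z.re
  have h4 := Int.lt_floor_add_one z.re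
  have h5 := Int.floor_le z.im
  have h6 := Int.lt_floor_add_one z.im
  refine ⟨⟨?_, ?_⟩, ⟨?_, ?_⟩⟩ <;> rw [← Int.cast_le (R := ℝ)] <;> push_cast <;> linarith

lemma isClosed_biUnion_cell (T : Set (ℤ × ℤ)) : IsClosed (⋃ c ∈ T, cell c) := by
  rw [biUnion_eq_iUnion]
  exact (locallyFinite_cell.comp_injective Subtype.val_injective).isClosed_iUnion
    fun c ↦ isClosed_cell c

lemma abs_sub_le_one_of_mem {m n : ℤ} {x : ℝ} (h : (m : ℝ) ≤ x ∧ x ≤ m + 1)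
    (h' : (n : ℝ) ≤ x ∧ x ≤ n + 1) : (m - n).natAbs ≤ 1 := by
  have h1 : m ≤ n + 1 := by rw [← Int.cast_le (R := ℝ)]; push_cast; linarith
  have h2 : n ≤ m + 1 := by rw [← Int.cast_le (R := ℝ)]; push_cast; linarith
  omega

lemma exists_adj_of_mem_cell {T : Set (ℤ × ℤ)} {z : ℂ} {c c' : ℤ × ℤ} (hc : c ∈ T)
    (hc' : c' ∉ T) (hz : z ∈ cell c) (hz' : z ∈ cell c') :
    ∃ a ∈ T, ∃ b ∉ T, Adj a b ∧ z ∈ cell a ∧ z ∈ cell b := by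
  have h1 := abs_sub_le_one_of_mem hz.1 hz'.1
  have h2 := abs_sub_le_one_of_mem hz.2 hz'.2
  have hm : z ∈ cell (c'.1, c.2) := ⟨hz'.1, hz.2⟩
  by_cases h : (c'.1, c.2) ∈ T
  · refine ⟨_, h, c', hc', ?_, hm, hz'⟩
    have : c.2 ≠ c'.2 := fun e ↦ hc' (by rwa [e] at h)
    unfold Adj; dsimp only; omega
  · refine ⟨c, hc, _, h, ?_, hz, hm⟩
    have : c.1 ≠ c'.1 := fun e ↦ h (by rwa [← e])
    unfold Adj; dsimp only; omega

/-- A property of squares that is inherited by adjacent squares among those meeting a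
preconnected set `S` holds for all squares meeting `S` if it holds for one of them. -/
lemma mem_of_isPreconnected {S : Set ℂ} (hS : IsPreconnected S) {T : Set (ℤ × ℤ)}
    (hT : ∀ a ∈ T, ∀ b, Adj a b → (cell a ∩ S).Nonempty → (cell b ∩ S).Nonempty → b ∈ T)
    {c : ℤ × ℤ} (hc : c ∈ T) (hcS : (cell c ∩ S).Nonempty) {c' : ℤ × ℤ}
    (hcS' : (cell c' ∩ S).Nonempty) : c' ∈ T := by
  by_contra hc'
  obtain ⟨z, hz, hzS⟩ := hcS
  obtain ⟨z', hz', hzS'⟩ := hcS'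
  have hcov : S ⊆ (⋃ c ∈ T, cell c) ∪ ⋃ c ∈ Tᶜ, cell c := fun w _ ↦ by
    by_cases h : (⌊w.re⌋, ⌊w.im⌋) ∈ T
    · exact .inl (mem_biUnion h (mem_cell_floor w))
    · exact .inr (mem_biUnion (show _ ∈ Tᶜ from h) (mem_cell_floor w))
  obtain ⟨x, hxS, hx, hx'⟩ := isPreconnected_closed_iff.1 hS _ _ (isClosed_biUnion_cell T)
    (isClosed_biUnion_cell Tᶜ) hcov ⟨z, hzS, mem_biUnion hc hz⟩
    ⟨z', hzS', mem_biUnion (show c' ∈ Tᶜ from hc') hz'⟩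
  obtain ⟨d, hd, hxd⟩ := mem_iUnion₂.1 hx
  obtain ⟨d', hd', hxd'⟩ := mem_iUnion₂.1 hx'
  obtain ⟨a, ha, b, hb, hab, hxa, hxb⟩ := exists_adj_of_mem_cell hd hd' hxd hxd'
  exact hb (hT a ha b hab ⟨x, hxa, hxS⟩ ⟨x, hxb, hxS⟩)

/-- The point at parameter `t` on the line through the lattice points `p` and `q`. -/
def edgePoint (p q : ℤ × ℤ) (t : ℝ) : ℂ :=
  ⟨p.1 + t * (q.1 - p.1), p.2 + t * (q.2 - p.2)⟩

lemma continuous_edgePoint (p q : ℤ × ℤ) : Continuous (edgePoint p q) := by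
  have : edgePoint p q = fun t ↦ ((p.1 + t * (q.1 - p.1) : ℝ) : ℂ) +
      ((p.2 + t * (q.2 - p.2) : ℝ) : ℂ) * Complex.I := by
    ext t
    exact Complex.mk_eq_add_mul_I _ _
  rw [this]
  fun_prop

lemma edgePoint_zero (p q : ℤ × ℤ) : edgePoint p q 0 = ⟨p.1, p.2⟩ := by simp [edgePoint]

lemma edgePoint_one (p q : ℤ × ℤ) : edgePoint p q 1 = ⟨q.1, q.2⟩ := by simp [edgePoint]

lemma edgePoint_mem {p q : ℤ × ℤ} (h : Adj p q) {t : ℝ} (ht : t ∈ Icc (0 : ℝ) 1) :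
    edgePoint p q t ∈ cell (upperCell p q) ∩ cell (lowerCell p q) := by
  obtain ⟨p1, p2⟩ := p
  obtain ⟨h0, h1⟩ := ht
  rcases adj_cases h with rfl | rfl | rfl | rfl <;>
    simp only [edgePoint, mem_inter_iff, mem_cell, upperCell, lowerCell, min_self, max_self,
      Int.cast_sub, Int.cast_add, Int.cast_one, Int.cast_max, Int.cast_min] <;>
    simp <;> constructorm* _ ∧ _ <;> linarith

lemma exists_edgePoint_eq {p q : ℤ × ℤ} (h : Adj p q) {z : ℂ}
    (hz : z ∈ cell (upperCell p q) ∩ cell (lowerCell p q)) :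
    ∃ t ∈ Icc (0 : ℝ) 1, edgePoint p q t = z := by
  obtain ⟨p1, p2⟩ := p
  obtain ⟨x, y⟩ := z
  rcases adj_cases h with rfl | rfl | rfl | rfl <;>
    simp [edgePoint, mem_cell, upperCell, lowerCell] at hz ⊢
  · exact ⟨x - p1, ⟨by linarith, by linarith⟩, by linarith, by linarith⟩
  · exact ⟨p1 - x, ⟨by linarith, by linarith⟩, by linarith, by linarith⟩
  · exact ⟨y - p2, ⟨by linarith, by linarith⟩, by linarith, by linarith⟩
  · exact ⟨p2 - y, ⟨by linarith, by linarith⟩, by linarith, by linarith⟩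

lemma eq_floor_ceil_of_edgePoint {p q : ℤ × ℤ} (h : Adj p q) {t : ℝ} (ht : t ∈ Ioo (0 : ℝ) 1) :
    (p = (⌊(edgePoint p q t).re⌋, ⌊(edgePoint p q t).im⌋) ∧
      q = (⌈(edgePoint p q t).re⌉, ⌈(edgePoint p q t).im⌉)) ∨
    (q = (⌊(edgePoint p q t).re⌋, ⌊(edgePoint p q t).im⌋) ∧
      p = (⌈(edgePoint p q t).re⌉, ⌈(edgePoint p q t).im⌉)) := by
  obtain ⟨p1, p2⟩ := p
  obtain ⟨h0, h1⟩ := ht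
  have a1 : ⌊t⌋ = 0 := Int.floor_eq_zero_iff.2 ⟨h0.le, h1⟩
  have a2 : ⌈t⌉ = 1 := Int.ceil_eq_iff.2 (by constructor <;> simp [h0, h1.le])
  have a3 : ⌊-t⌋ = -1 := by rw [Int.floor_neg, a2]
  have a4 : ⌈-t⌉ = 0 := by rw [Int.ceil_neg, a1]; rfl
  rcases adj_cases h with rfl | rfl | rfl | rfl <;> simp [edgePoint, a1, a2, a3, a4] <;> omega

lemma eq_of_edgePoint_eq {p q p' q' : ℤ × ℤ} (h : Adj p q) (h' : Adj p' q') {t t' : ℝ}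
    (ht : t ∈ Ico (0 : ℝ) 1) (ht' : t' ∈ Ico (0 : ℝ) 1)
    (he : edgePoint p q t = edgePoint p' q' t') :
    (p = p' ∧ t = t') ∨ (p = q' ∧ q = p') := by
  rcases ht.1.eq_or_lt with rfl | h0 <;> rcases ht'.1.eq_or_lt with rfl | h0'
  · simp only [edgePoint_zero, Complex.mk.injEq, Int.cast_inj] at he
    exact .inl ⟨Prod.ext he.1 he.2, rfl⟩
  · exfalso
    have := eq_floor_ceil_of_edgePoint h' ⟨h0', ht'.2⟩
    rw [← he, edgePoint_zero] at this
    simp only [Int.floor_intCast, Int.ceil_intCast] at this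
    have : p' = q' := by rcases this with ⟨h1, h2⟩ | ⟨h1, h2⟩ <;> rw [h1, h2]
    simp [Adj, this] at h'
  · exfalso
    have := eq_floor_ceil_of_edgePoint h ⟨h0, ht.2⟩
    rw [he, edgePoint_zero] at this
    simp only [Int.floor_intCast, Int.ceil_intCast] at this
    have : p = q := by rcases this with ⟨h1, h2⟩ | ⟨h1, h2⟩ <;> rw [h1, h2]
    simp [Adj, this] at h
  · have e1 := eq_floor_ceil_of_edgePoint h ⟨h0, ht.2⟩
    have e2 := eq_floor_ceil_of_edgePoint h' ⟨h0', ht'.2⟩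
    rw [← he] at e2
    have key : (p = p' ∧ q = q') ∨ (p = q' ∧ q = p') := by
      rcases e1 with ⟨h1, h2⟩ | ⟨h1, h2⟩ <;> rcases e2 with ⟨h3, h4⟩ | ⟨h3, h4⟩
      · exact .inl ⟨h1.trans h3.symm, h2.trans h4.symm⟩
      · exact .inr ⟨h1.trans h3.symm, h2.trans h4.symm⟩
      · exact .inr ⟨h2.trans h4.symm, h1.trans h3.symm⟩
      · exact .inl ⟨h2.trans h4.symm, h1.trans h3.symm⟩
    rcases key with ⟨rfl, rfl⟩ | key
    · refine .inl ⟨rfl, ?_⟩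
      obtain ⟨p1, p2⟩ := p
      rcases adj_cases h with rfl | rfl | rfl | rfl <;> simp [edgePoint] at he <;> linarith
    · exact .inr key

/-- The polygonal curve through the lattice points `f k`, `k : ℤ`. -/
noncomputable def polygon (f : ℤ → ℤ × ℤ) (t : ℝ) : ℂ :=
  edgePoint (f ⌊t⌋) (f (⌊t⌋ + 1)) (t - ⌊t⌋)

lemma polygon_eq (f : ℤ → ℤ × ℤ) {k : ℤ} {t : ℝ} (ht : t ∈ Icc (k : ℝ) (k + 1)) :
    polygon f t = edgePoint (f k) (f (k + 1)) (t - k) := by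
  rcases ht.2.eq_or_lt with h | h
  · have : ⌊t⌋ = k + 1 := by rw [h]; simp
    rw [polygon, this, h]
    simp [edgePoint_zero, edgePoint_one]
  · rw [polygon, Int.floor_eq_iff.2 ⟨ht.1, h⟩]

lemma continuous_polygon (f : ℤ → ℤ × ℤ) : Continuous (polygon f) := by
  have hfin : LocallyFinite fun k : ℤ ↦ Icc (k : ℝ) (k + 1) := by
    intro x
    refine ⟨ball x 1, ball_mem_nhds x one_pos,
      (Set.finite_Icc (⌊x⌋ - 2) (⌊x⌋ + 2)).subset ?_⟩
    rintro k ⟨w, hw, hwx⟩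
    rw [mem_ball, Real.dist_eq, abs_lt] at hwx
    have h3 := Int.floor_le x
    have h4 := Int.lt_floor_add_one x
    obtain ⟨h5, h6⟩ := hw
    constructor <;> rw [← Int.cast_le (R := ℝ)] <;> push_cast <;> linarith
  refine hfin.continuous ?_ (fun k ↦ isClosed_Icc) fun k ↦ ?_
  · exact eq_univ_of_forall fun x ↦
      mem_iUnion.2 ⟨⌊x⌋, Int.floor_le x, (Int.lt_floor_add_one x).le⟩
  · exact ((continuous_edgePoint (f k) (f (k + 1))).comp
      (continuous_sub_right (k : ℝ))).continuousOn.congr fun t ht ↦ polygon_eq f ht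

lemma IsSimpleLoop.polygon_periodic {f : ℤ → ℤ × ℤ} {n : ℕ} (hf : IsSimpleLoop f n) (t : ℝ) :
    polygon f (t + n) = polygon f t := by
  have h : ⌊t + n⌋ = ⌊t⌋ + n := Int.floor_add_natCast t n
  rw [polygon, h, polygon, hf.periodic, add_right_comm, hf.periodic]
  push_cast
  rw [add_sub_add_right_eq_sub]

lemma IsSimpleLoop.injOn_polygon {f : ℤ → ℤ × ℤ} {n : ℕ} (hf : IsSimpleLoop f n) :
    InjOn (polygon f) (Ico 0 (n : ℝ)) := by
  intro s hs t ht he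
  have hfl : ∀ x : ℝ, x - ⌊x⌋ ∈ Ico (0 : ℝ) 1 := fun x ↦
    ⟨by linarith [Int.floor_le x], by linarith [Int.lt_floor_add_one x]⟩
  have hr : ∀ x ∈ Ico (0 : ℝ) n, 0 ≤ ⌊x⌋ ∧ ⌊x⌋ < n := fun x hx ↦
    ⟨Int.floor_nonneg.2 hx.1, Int.floor_lt.2 (by exact_mod_cast hx.2)⟩
  have h := eq_of_edgePoint_eq (hf.adj _) (hf.adj _) (hfl s) (hfl t) he
  have hd : (n : ℤ) ∣ ⌊s⌋ - ⌊t⌋ := by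
    rcases h with h | h
    · exact hf.dvd_of_eq _ _ h.1
    · exact hf.dvd_of_separates (.inr h)
  have h1 := hr s hs
  have h2 := hr t ht
  have h3 := Int.eq_zero_of_abs_lt_dvd hd (by rw [abs_lt]; omega)
  have h4 : ⌊s⌋ = ⌊t⌋ := by omega
  rcases h with h | h
  · have := h.2
    rw [h4] at this
    linarith
  · have := hf.adj ⌊t⌋
    rw [← h.1, h4] at this
    simp [Adj] at this

lemma IsSimpleLoop.exists_curve {f : ℤ → ℤ × ℤ} {n : ℕ} (hf : IsSimpleLoop f n) :
    ∃ γ : sphere (0 : ℂ) 1 → ℂ, Continuous γ ∧ Function.Injective γ ∧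
      range γ = range (polygon f) := by
  have hn : (0 : ℝ) < n := by
    have := hf.three_le
    exact_mod_cast (by omega : 0 < n)
  have : Fact ((0 : ℝ) < n) := ⟨hn⟩
  have hper : Function.Periodic (polygon f) (n : ℝ) := hf.polygon_periodic
  have hcont : Continuous hper.lift := (continuous_polygon f).quotient_lift _
  have hinj : Function.Injective hper.lift := by
    intro x y hxy
    obtain ⟨s, hs, rfl⟩ := AddCircle.coe_image_Ico_eq (n : ℝ) 0 ▸ mem_univ x
    obtain ⟨t, ht, rfl⟩ := AddCircle.coe_image_Ico_eq (n : ℝ) 0 ▸ mem_univ y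
    rw [zero_add] at hs ht
    rw [hf.injOn_polygon hs ht hxy]
  let e : sphere (0 : ℂ) 1 ≃ₜ AddCircle (n : ℝ) :=
    (show sphere (0 : ℂ) 1 ≃ₜ Circle from Homeomorph.refl Circle).trans
      (AddCircle.homeomorphCircle hn.ne').symm
  refine ⟨hper.lift ∘ e, hcont.comp e.continuous, hinj.comp e.injective, ?_⟩
  rw [e.surjective.range_comp]
  ext z
  constructor
  · rintro ⟨x, rfl⟩
    obtain ⟨t, rfl⟩ := QuotientAddGroup.mk_surjective x
    exact ⟨t, rfl⟩
  · rintro ⟨t, rfl⟩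
    exact ⟨t, rfl⟩

lemma closure_interior_cell (c : ℤ × ℤ) : closure (interior (cell c)) = cell c := by
  rw [cell, Complex.interior_reProdIm, Complex.closure_reProdIm, interior_Icc, interior_Icc,
    closure_Ioo (by simp), closure_Ioo (by simp)]

lemma eq_of_mem_interior_cell {c c' : ℤ × ℤ} {z : ℂ} (hz : z ∈ interior (cell c))
    (hz' : z ∈ cell c') : c' = c := by
  rw [cell, Complex.interior_reProdIm, interior_Icc, interior_Icc] at hz
  obtain ⟨⟨h1, h2⟩, h3, h4⟩ := hz
  obtain ⟨⟨h5, h6⟩, h7, h8⟩ := hz'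
  have e1 : c'.1 < c.1 + 1 := by rw [← Int.cast_lt (R := ℝ)]; push_cast; linarith
  have e2 : c.1 < c'.1 + 1 := by rw [← Int.cast_lt (R := ℝ)]; push_cast; linarith
  have e3 : c'.2 < c.2 + 1 := by rw [← Int.cast_lt (R := ℝ)]; push_cast; linarith
  have e4 : c.2 < c'.2 + 1 := by rw [← Int.cast_lt (R := ℝ)]; push_cast; linarith
  exact Prod.ext (by omega) (by omega)

lemma Adj.exists_mem_cell {a b : ℤ × ℤ} (h : Adj a b) :
    ∃ z ∈ cell a, z ∈ cell b ∧ ∀ c, z ∈ cell c → c = a ∨ c = b := by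
  have hc : (a.1 = b.1 ∨ a.1 = b.1 + 1 ∨ b.1 = a.1 + 1) ∧
      (a.2 = b.2 ∨ a.2 = b.2 + 1 ∨ b.2 = a.2 + 1) := by unfold Adj at h; omega
  have h1 : |(a.1 : ℝ) - b.1| ≤ 1 := by
    obtain ⟨h | h | h, -⟩ := hc <;> rw [h] <;> simp
  have h2 : |(a.2 : ℝ) - b.2| ≤ 1 := by
    obtain ⟨-, h | h | h⟩ := hc <;> rw [h] <;> simp
  rw [abs_le] at h1 h2
  refine ⟨⟨(a.1 + b.1 + 1) / 2, (a.2 + b.2 + 1) / 2⟩, ?_, ?_, fun c hc ↦ ?_⟩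
  · rw [mem_cell]; dsimp only; constructorm* _ ∧ _ <;> linarith
  · rw [mem_cell]; dsimp only; constructorm* _ ∧ _ <;> linarith
  · obtain ⟨⟨h5, h6⟩, h7, h8⟩ := hc
    dsimp only at h5 h6 h7 h8
    have e1 : 2 * c.1 ≤ a.1 + b.1 + 1 := by rw [← Int.cast_le (R := ℝ)]; push_cast; linarith
    have e2 : a.1 + b.1 ≤ 2 * c.1 + 1 := by rw [← Int.cast_le (R := ℝ)]; push_cast; linarith
    have e3 : 2 * c.2 ≤ a.2 + b.2 + 1 := by rw [← Int.cast_le (R := ℝ)]; push_cast; linarith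
    have e4 : a.2 + b.2 ≤ 2 * c.2 + 1 := by rw [← Int.cast_le (R := ℝ)]; push_cast; linarith
    simp only [Adj, Prod.ext_iff] at *
    omega

/-- The union of the squares in a set. -/
def region (T : Set (ℤ × ℤ)) : Set ℂ := ⋃ c ∈ T, cell c

lemma mem_region {T : Set (ℤ × ℤ)} {z : ℂ} : z ∈ region T ↔ ∃ c ∈ T, z ∈ cell c := by
  simp [region]

lemma isClosed_region (T : Set (ℤ × ℤ)) : IsClosed (region T) := isClosed_biUnion_cell T

lemma region_union_region_compl (T : Set (ℤ × ℤ)) : region T ∪ region Tᶜ = univ := by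
  refine eq_univ_of_forall fun w ↦ ?_
  by_cases h : (⌊w.re⌋, ⌊w.im⌋) ∈ T
  · exact .inl (mem_region.2 ⟨_, h, mem_cell_floor w⟩)
  · exact .inr (mem_region.2 ⟨_, h, mem_cell_floor w⟩)

lemma isBounded_region {T : Set (ℤ × ℤ)} (hT : T.Finite) : Bornology.IsBounded (region T) :=
  (Bornology.isBounded_biUnion hT).2 fun _ _ ↦
    isBounded_iff.2 ⟨2, fun _ hz _ hw ↦ dist_le_of_mem_cell hz hw⟩

lemma isPreconnected_compl_region {T : Set (ℤ × ℤ)} (hT : ∀ a ∉ T, ∀ b ∉ T, JoinedIn Tᶜ a b) :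
    IsPreconnected (region T)ᶜ := by
  have h : (region T)ᶜ = ⋃ c ∈ Tᶜ, cell c \ region T := by
    ext z
    simp only [mem_compl_iff, mem_iUnion, mem_sdiff, exists_prop]
    constructor
    · intro hz
      obtain ⟨c, hc, hzc⟩ := mem_region.1
        ((region_union_region_compl T ▸ mem_univ z).resolve_left hz)
      exact ⟨c, hc, hzc, hz⟩
    · rintro ⟨-, -, -, hz⟩
      exact hz
  rw [h]
  refine IsPreconnected.biUnion_of_reflTransGen (fun c hc ↦ ?_) fun a ha b hb ↦ ?_
  · refine (convex_cell c).interior.isPreconnected.subset_closure (fun z hz ↦ ?_) ?_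
    · refine ⟨interior_subset hz, fun hz' ↦ hc ?_⟩
      obtain ⟨d, hd, hzd⟩ := mem_region.1 hz'
      rwa [← eq_of_mem_interior_cell hz hzd]
    · rw [closure_interior_cell]
      exact sdiff_subset
  · refine Relation.ReflTransGen.mono (fun c d ⟨hcd, hc, hd⟩ ↦ ⟨?_, hc⟩) _ _ (hT a ha b hb)
    obtain ⟨z, hzc, hzd, hz⟩ := hcd.exists_mem_cell
    have : z ∉ region T := fun hzT ↦ by
      obtain ⟨x, hx, hzx⟩ := mem_region.1 hzT
      rcases hz x hzx with rfl | rfl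
      exacts [hc hx, hd hx]
    exact ⟨z, ⟨hzc, this⟩, hzd, this⟩

lemma exists_curve_region {D : Set (ℤ × ℤ)} (hfin : D.Finite) (hne : D.Nonempty)
    (hD : ∀ a ∈ D, ∀ b ∈ D, JoinedIn D a b) (hDc : ∀ a ∉ D, ∀ b ∉ D, JoinedIn Dᶜ a b) :
    ∃ γ : sphere (0 : ℂ) 1 → ℂ, Continuous γ ∧ Function.Injective γ ∧
      range γ = region D ∩ region Dᶜ := by
  obtain ⟨f, n, hf, hfD, hDf⟩ := exists_boundary_loop hfin hne hD hDc
  obtain ⟨γ, hγ, hγi, hγr⟩ := hf.exists_curve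
  refine ⟨γ, hγ, hγi, hγr.trans (Subset.antisymm ?_ ?_)⟩
  · rintro _ ⟨t, rfl⟩
    have hmem := edgePoint_mem (hf.adj ⌊t⌋) (t := t - ⌊t⌋)
      ⟨by linarith [Int.floor_le t], by linarith [Int.lt_floor_add_one t]⟩
    have hb := (hfD ⌊t⌋).2
    by_cases hu : upperCell (f ⌊t⌋) (f (⌊t⌋ + 1)) ∈ D
    · exact ⟨mem_region.2 ⟨_, hu, hmem.1⟩, mem_region.2 ⟨_, fun hl ↦ hb (by tauto), hmem.2⟩⟩
    · exact ⟨mem_region.2 ⟨_, by_contra fun hl ↦ hb (by tauto), hmem.2⟩,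
        mem_region.2 ⟨_, hu, hmem.1⟩⟩
  · rintro z ⟨hz, hz'⟩
    obtain ⟨c, hc, hzc⟩ := mem_region.1 hz
    obtain ⟨c', hc', hzc'⟩ := mem_region.1 hz'
    obtain ⟨a, ha, b, hb, hab, hza, hzb⟩ := exists_adj_of_mem_cell hc hc' hzc hzc'
    obtain ⟨k, hk⟩ := hDf a ha b hb hab
    have hzk : z ∈ cell (upperCell (f k) (f (k + 1))) ∩ cell (lowerCell (f k) (f (k + 1))) := by
      rcases hk with ⟨rfl, rfl⟩ | ⟨rfl, rfl⟩
      exacts [⟨hza, hzb⟩, ⟨hzb, hza⟩]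
    obtain ⟨t, ht, rfl⟩ := exists_edgePoint_eq (hf.adj k) hzk
    refine ⟨k + t, ?_⟩
    rw [polygon_eq f (k := k) ⟨by linarith [ht.1], by linarith [ht.2]⟩, add_sub_cancel_left]

lemma inter_frontier_nonempty {X : Type*} [TopologicalSpace X] {s t : Set X}
    (hs : IsPreconnected s) (h : (s ∩ t).Nonempty) (h' : (s ∩ tᶜ).Nonempty) :
    (s ∩ frontier t).Nonempty := by
  by_contra! hcon
  have hf : ∀ x ∈ s, x ∉ frontier t := fun x hx hxt ↦ hcon.subset ⟨hx, hxt⟩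
  have hcov : ∀ x ∈ s, x ∈ interior t ∨ x ∉ closure t := fun x hx ↦ by
    have := hf x hx
    rw [frontier, mem_sdiff] at this
    tauto
  obtain ⟨x, hx, hxt⟩ := h
  obtain ⟨y, hy, hyt⟩ := h'
  obtain ⟨z, -, hz, hz'⟩ := hs _ _ isOpen_interior isClosed_closure.isOpen_compl hcov
    ⟨x, hx, (hcov x hx).resolve_right fun h ↦ h (subset_closure hxt)⟩
    ⟨y, hy, (hcov y hy).resolve_left fun h ↦ hyt (interior_subset h)⟩
  exact hz' (interior_subset_closure hz)

lemma JoinedIn.mem {S : Set (ℤ × ℤ)} {a b : ℤ × ℤ} (h : JoinedIn S a b) (ha : a ∈ S) : b ∈ S := by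
  induction h with
  | refl => exact ha
  | tail _ h _ => exact h.2.2

lemma JoinedIn.mono {S T : Set (ℤ × ℤ)} {a b : ℤ × ℤ} (h : JoinedIn S a b) (hST : S ⊆ T) :
    JoinedIn T a b :=
  Relation.ReflTransGen.mono (fun _ _ h ↦ ⟨h.1, hST h.2.1, hST h.2.2⟩) _ _ h

lemma JoinedIn.within {S : Set (ℤ × ℤ)} {a b : ℤ × ℤ} (h : JoinedIn S a b) :
    JoinedIn {c | JoinedIn S a c} a b := by
  induction h with
  | refl => exact .refl
  | tail h1 h2 ih => exact ih.tail ⟨h2.1, h1, h1.tail h2⟩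

lemma exists_adj_of_mem_of_notMem {T : Set (ℤ × ℤ)} {c c' : ℤ × ℤ} (hc : c ∈ T) (hc' : c' ∉ T) :
    ∃ a ∈ T, ∃ b ∉ T, Adj a b := by
  by_contra! h
  exact hc' (mem_of_isPreconnected isPreconnected_univ
    (fun a ha b hab _ _ ↦ by_contra fun hb ↦ h a ha b hb hab) hc
    ⟨⟨c.1, c.2⟩, by simp [mem_cell], trivial⟩
    ⟨⟨c'.1, c'.2⟩, by simp [mem_cell], trivial⟩)

/-- A set `E` contained in `K ∩ N` can be separated from `K \ N` by a simple closed curve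
avoiding `K` if the frontier of `N` is contained in a connected set `C` that is far from `K`
on the scale of the unit grid. -/
theorem exists_curve_of_disjoint_cell {E K C N : Set ℂ} (hN : Bornology.IsBounded N)
    (hC : IsPreconnected C) (hCne : C.Nonempty) (hNC : frontier N ⊆ C)
    (hCK : ∀ c, (cell c ∩ C).Nonempty → Disjoint (cell c) K)
    (hE : IsPreconnected E) (hEne : E.Nonempty) (hEK : E ⊆ K) (hEN : E ⊆ N) :
    ∃ γ : sphere (0 : ℂ) 1 → ℂ, Continuous γ ∧ Function.Injective γ ∧ Disjoint (range γ) K ∧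
      ∃ U V : Set ℂ, IsOpen U ∧ IsOpen V ∧ Disjoint U V ∧ U ∪ V = (range γ)ᶜ ∧
        IsPreconnected V ∧ Bornology.IsBounded U ∧ E ⊆ U ∧ K \ N ⊆ V := by
  obtain ⟨x, hx⟩ := hCne
  obtain ⟨e, he⟩ := hEne
  let Q : Set (ℤ × ℤ) := {c | Disjoint (cell c) K}
  let R : Set (ℤ × ℤ) := {c | JoinedIn Q (⌊x.re⌋, ⌊x.im⌋) c}
  let D : Set (ℤ × ℤ) := {c | JoinedIn Rᶜ (⌊e.re⌋, ⌊e.im⌋) c}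
  have hRQ : R ⊆ Q := fun c hc ↦ hc.mem (hCK _ ⟨x, mem_cell_floor x, hx⟩)
  have hCR : ∀ c, (cell c ∩ C).Nonempty → c ∈ R := fun c hc ↦
    mem_of_isPreconnected hC (fun a ha b hab h1 h2 ↦ ha.tail ⟨hab, hCK _ h1, hCK _ h2⟩)
      (show _ ∈ R from .refl) ⟨x, mem_cell_floor x, hx⟩ hc
  have hER : ∀ c, (cell c ∩ E).Nonempty → c ∈ Rᶜ := fun c ⟨z, hzc, hz⟩ hc ↦
    disjoint_left.1 (hRQ hc) hzc (hEK hz)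
  have hED : ∀ c, (cell c ∩ E).Nonempty → c ∈ D := fun c hc ↦
    mem_of_isPreconnected hE (fun a ha b hab h1 h2 ↦ ha.tail ⟨hab, hER _ h1, hER _ h2⟩)
      (show _ ∈ D from .refl) ⟨e, mem_cell_floor e, he⟩ hc
  have hDR : D ⊆ Rᶜ := fun c hc ↦ hc.mem (hER _ ⟨e, mem_cell_floor e, he⟩)
  have hsub : ∀ c ∈ Rᶜ, (cell c ∩ N).Nonempty → cell c ⊆ N := fun c hc h ↦ by
    by_contra hcN
    obtain ⟨z, hz, hzN⟩ := inter_frontier_nonempty (convex_cell c).isPreconnected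
      h (by rwa [← inter_compl_nonempty_iff] at hcN)
    exact hc (hCR c ⟨z, hz, hNC hzN⟩)
  have hDN : ∀ c ∈ D, cell c ⊆ N := fun c hc ↦ by
    induction hc with
    | refl => exact hsub _ (hER _ ⟨e, mem_cell_floor e, he⟩) ⟨e, mem_cell_floor e, hEN he⟩
    | tail _ h ih =>
      obtain ⟨z, hz, hz', -⟩ := h.1.exists_mem_cell
      exact hsub _ h.2.2 ⟨z, hz', ih hz⟩
  have hfin : D.Finite := (locallyFinite_cell.finite_nonempty_inter_compact
    hN.isCompact_closure).subset fun c hc ↦ by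
      have hz : (⟨c.1, c.2⟩ : ℂ) ∈ cell c := by simp [mem_cell]
      exact ⟨_, hz, subset_closure (hDN c hc hz)⟩
  have hRD : R ⊆ Dᶜ := subset_compl_comm.1 hDR
  have hadj : ∀ a ∉ R, ∀ b, Adj a b → ¬JoinedIn Rᶜ a b → b ∈ R := fun a ha b hab h ↦
    by_contra fun hb ↦ h (.single ⟨hab, ha, hb⟩)
  have hDc : ∀ c ∉ D, JoinedIn Dᶜ (⌊x.re⌋, ⌊x.im⌋) c := fun c hc ↦ by
    by_cases hcR : c ∈ R
    · exact (JoinedIn.within hcR).mono hRD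
    · obtain ⟨a, ha, b, hb, hab⟩ := exists_adj_of_mem_of_notMem
        (T := {d | JoinedIn Rᶜ c d}) (c := c) (c' := (⌊x.re⌋, ⌊x.im⌋)) .refl
        fun h ↦ h.mem hcR .refl
      have hbR : b ∈ R := hadj a (JoinedIn.mem ha hcR) b hab fun h ↦ hb (ha.trans h)
      have hca : JoinedIn Dᶜ c a := (JoinedIn.within ha).mono fun d hd hdD ↦
        hc (Relation.ReflTransGen.trans hdD hd.symm)
      refine ((JoinedIn.within hbR).mono hRD).trans (JoinedIn.symm (hca.tail ⟨hab, ?_, hRD hbR⟩))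
      exact fun haD ↦ hc (Relation.ReflTransGen.trans haD (JoinedIn.symm ha))
  have hDc' : ∀ a ∉ D, ∀ b ∉ D, JoinedIn Dᶜ a b := fun a ha b hb ↦
    (hDc a ha).symm.trans (hDc b hb)
  obtain ⟨γ, hγ, hγi, hγr⟩ := exists_curve_region hfin ⟨_, .refl⟩
    (fun a ha b hb ↦ (JoinedIn.within ha).symm.trans (JoinedIn.within hb)) hDc'
  refine ⟨γ, hγ, hγi, ?_, (region Dᶜ)ᶜ, (region D)ᶜ, (isClosed_region _).isOpen_compl,
    (isClosed_region _).isOpen_compl, ?_, ?_, isPreconnected_compl_region hDc',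
    (isBounded_region hfin).subset ?_, ?_, ?_⟩
  · rw [hγr, disjoint_left]
    rintro z ⟨hz, hz'⟩ hzK
    obtain ⟨c, hc, hzc⟩ := mem_region.1 hz
    obtain ⟨c', hc', hzc'⟩ := mem_region.1 hz'
    obtain ⟨a, ha, b, hb, hab, hza, hzb⟩ := exists_adj_of_mem_cell hc hc' hzc hzc'
    have hbR : b ∈ R := hadj a (hDR ha) b hab fun h ↦ hb (Relation.ReflTransGen.trans ha h)
    exact disjoint_left.1 (hRQ hbR) hzb hzK
  · rw [disjoint_compl_left_iff_subset, compl_subset_iff_union]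
    exact region_union_region_compl D
  · rw [hγr, compl_inter, union_comm]
  · rw [compl_subset_iff_union, union_comm]
    exact region_union_region_compl D
  · intro z hz hz'
    obtain ⟨c, hc, hzc⟩ := mem_region.1 hz'
    exact hc (hED c ⟨z, hzc, hz⟩)
  · rintro z ⟨-, hz⟩ hz'
    obtain ⟨c, hc, hzc⟩ := mem_region.1 hz'
    exact hz (hDN c hc hzc)

lemma exists_isCompact_isPreconnected {U S : Set ℂ} (hU : IsOpen U) (hUc : IsConnected U)
    (hS : IsCompact S) (hSU : S ⊆ U) :
    ∃ C, IsCompact C ∧ IsPreconnected C ∧ C.Nonempty ∧ S ⊆ C ∧ C ⊆ U := by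
  have hpath := hU.isConnected_iff_isPathConnected.1 hUc
  obtain ⟨x, hx⟩ := hUc.nonempty
  suffices h : ∃ C, IsCompact C ∧ IsPreconnected C ∧ x ∈ C ∧ S ⊆ C ∧ C ⊆ U by
    obtain ⟨C, h1, h2, h3, h4⟩ := h
    exact ⟨C, h1, h2, ⟨x, h3⟩, h4⟩
  refine hS.induction_on
    (p := fun s ↦ ∃ C, IsCompact C ∧ IsPreconnected C ∧ x ∈ C ∧ s ⊆ C ∧ C ⊆ U) ?_ ?_ ?_ ?_
  · exact ⟨{x}, isCompact_singleton, isPreconnected_singleton, rfl, empty_subset _,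
      singleton_subset_iff.2 hx⟩
  · rintro s t hst ⟨C, h1, h2, h3, h4, h5⟩
    exact ⟨C, h1, h2, h3, hst.trans h4, h5⟩
  · rintro s t ⟨C, h1, h2, h3, h4, h5⟩ ⟨C', h1', h2', h3', h4', h5'⟩
    exact ⟨C ∪ C', h1.union h1', h2.union x h3 h3' h2', .inl h3, union_subset_union h4 h4',
      union_subset h5 h5'⟩
  · intro y hy
    obtain ⟨r, hr, hrU⟩ := Metric.nhds_basis_closedBall.mem_iff.1 (hU.mem_nhds (hSU hy))
    obtain ⟨γ, hγ⟩ := hpath.joinedIn x hx y (hSU hy)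
    refine ⟨closedBall y r, mem_nhdsWithin_of_mem_nhds (closedBall_mem_nhds y hr),
      range γ ∪ closedBall y r, (isCompact_range γ.continuous).union (isCompact_closedBall y r),
      (isPreconnected_range γ.continuous).union y ⟨1, γ.target⟩ (mem_closedBall_self hr.le)
        (convex_closedBall y r).isPreconnected, .inl ⟨0, γ.source⟩, subset_union_right,
      union_subset ?_ hrU⟩
    rintro _ ⟨t, rfl⟩
    exact hγ t

/-- If `N` is a bounded set whose frontier lies in the planar domain `W`, then a connected subset
of `N \ W` can be separated from the points outside `W` and `N` by a simple closed curve in `W`. -/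
theorem exists_curve_of_frontier_subset {E N W : Set ℂ} (hW : IsOpen W) (hWc : IsConnected W)
    (hN : Bornology.IsBounded N) (hNW : frontier N ⊆ W)
    (hE : IsPreconnected E) (hEne : E.Nonempty) (hEW : E ⊆ Wᶜ) (hEN : E ⊆ N) :
    ∃ γ : sphere (0 : ℂ) 1 → ℂ, Continuous γ ∧ Function.Injective γ ∧ range γ ⊆ W ∧
      ∃ U V : Set ℂ, IsOpen U ∧ IsOpen V ∧ Disjoint U V ∧ U ∪ V = (range γ)ᶜ ∧
        IsPreconnected V ∧ Bornology.IsBounded U ∧ E ⊆ U ∧ Wᶜ \ N ⊆ V := by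
  obtain ⟨C, hC, hCc, hCne, hNC, hCW⟩ := exists_isCompact_isPreconnected hW hWc
    (hN.isCompact_closure.of_isClosed_subset isClosed_frontier frontier_subset_closure) hNW
  obtain ⟨δ, hδ, hCδ⟩ := hC.exists_thickening_subset_open hW hCW
  have hdist : ∀ z ∈ C, ∀ w ∈ Wᶜ, δ ≤ dist w z := fun z hz w hw ↦ by
    by_contra! h
    exact hw (hCδ (mem_thickening_iff.2 ⟨z, hz, h⟩))
  have hr : (3 / δ : ℂ) ≠ 0 := div_ne_zero three_ne_zero (by exact_mod_cast hδ.ne')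
  let h : ℂ ≃ₜ ℂ := Homeomorph.mulLeft₀ (3 / δ : ℂ) hr
  have hh : ∀ z w, dist (h z) (h w) = 3 / δ * dist z w := fun z w ↦ by
    rw [dist_eq_norm, dist_eq_norm, show h z - h w = (3 / δ : ℂ) * (z - w) from
      (mul_sub _ _ _).symm, norm_mul, norm_div, Complex.norm_real, Real.norm_of_nonneg hδ.le]
    norm_num
  have hbdd : ∀ (g : ℂ ≃ₜ ℂ) {s : Set ℂ}, Bornology.IsBounded s → Bornology.IsBounded (g '' s) :=
    fun g s hs ↦ (hs.isCompact_closure.image g.continuous).isBounded.subset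
      (image_mono subset_closure)
  obtain ⟨γ, hγ, hγi, hγW, U, V, hU, hV, hUV, hUVγ, hVc, hUb, hEU, hNV⟩ :=
    exists_curve_of_disjoint_cell (E := h '' E) (K := h '' Wᶜ) (C := h '' C) (N := h '' N)
      (hbdd h hN) (hCc.image _ h.continuous.continuousOn) (hCne.image _)
      (by rw [← h.image_frontier]; exact image_mono hNC)
      (by
        rintro c ⟨_, hzc, z, hz, rfl⟩
        rw [disjoint_left]
        rintro _ hwc ⟨w, hw, rfl⟩
        have h1 := dist_le_of_mem_cell hwc hzc
        have h2 := mul_le_mul_of_nonneg_left (hdist z hz w hw) (div_pos three_pos hδ).le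
        rw [hh] at h1
        rw [div_mul_cancel₀ _ hδ.ne'] at h2
        linarith)
      (hE.image _ h.continuous.continuousOn) (hEne.image _) (image_mono hEW) (image_mono hEN)
  refine ⟨h.symm ∘ γ, h.symm.continuous.comp hγ, h.symm.injective.comp hγi, ?_, h.symm '' U,
    h.symm '' V, h.symm.isOpenMap _ hU, h.symm.isOpenMap _ hV,
    (disjoint_image_iff h.symm.injective).2 hUV, ?_, hVc.image _ h.symm.continuous.continuousOn,
    hbdd _ hUb, ?_, ?_⟩
  · rintro _ ⟨t, rfl⟩
    by_contra ht
    exact disjoint_left.1 hγW ⟨t, rfl⟩ ⟨_, ht, h.apply_symm_apply _⟩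
  · rw [← image_union, hUVγ, range_comp, image_compl_eq h.symm.bijective]
  · exact fun z hz ↦ ⟨h z, hEU ⟨z, hz, rfl⟩, h.symm_apply_apply z⟩
  · rintro z ⟨hz, hzN⟩
    refine ⟨h z, hNV ⟨⟨z, hz, rfl⟩, ?_⟩, h.symm_apply_apply z⟩
    rwa [h.injective.mem_set_image]

end SquareGrid

lemma exists_isOpen_connectedComponentIn_subset {X : Type*} [TopologicalSpace X] [T2Space X]
    {K F : Set X} (hK : IsCompact K) (hF : IsClosed F) {e : X} (he : e ∈ K)
    (hFe : Disjoint (connectedComponentIn K e) F) :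
    ∃ U V, IsOpen U ∧ IsOpen V ∧ Disjoint U V ∧ K ⊆ U ∪ V ∧ connectedComponentIn K e ⊆ U ∧
      K ∩ F ⊆ V := by
  have := isCompact_iff_compactSpace.1 hK
  rw [connectedComponentIn_eq_image he] at hFe ⊢
  have hdir : Directed (· ⊇ ·)
      fun s : {s : Set K // IsClopen s ∧ (⟨e, he⟩ : K) ∈ s} ↦ (s : Set K) := fun s t ↦
    ⟨⟨s ∩ t, s.2.1.inter t.2.1, s.2.2, t.2.2⟩, inter_subset_left, inter_subset_right⟩
  have : Nonempty {s : Set K // IsClopen s ∧ (⟨e, he⟩ : K) ∈ s} :=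
    ⟨⟨univ, isClopen_univ, trivial⟩⟩
  obtain ⟨⟨Z, hZ, heZ⟩, hZF⟩ := exists_subset_nhds_of_isCompact' hdir
    (fun s ↦ s.2.1.1.isCompact) (fun s ↦ s.2.1.1) (U := (↑) ⁻¹' Fᶜ) (fun x hx ↦ by
      rw [← connectedComponent_eq_iInter_isClopen] at hx
      exact (hF.isOpen_compl.preimage continuous_subtype_val).mem_nhds
        (disjoint_left.1 hFe ⟨x, hx, rfl⟩))
  obtain ⟨U, V, hU, hV, hZU, hZV, hUV⟩ := SeparatedNhds.of_isCompact_isCompact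
    (hZ.1.isCompact.image continuous_subtype_val)
    (hZ.compl.1.isCompact.image continuous_subtype_val)
    ((disjoint_image_iff Subtype.val_injective).2 disjoint_compl_right)
  refine ⟨U, V, hU, hV, hUV, fun x hx ↦ ?_, ?_, fun x hx ↦ ?_⟩
  · by_cases h : (⟨x, hx⟩ : K) ∈ Z
    · exact .inl (hZU ⟨_, h, rfl⟩)
    · exact .inr (hZV ⟨_, h, rfl⟩)
  · exact (image_mono (hZ.connectedComponent_subset heZ)).trans hZU
  · exact hZV ⟨⟨x, hx.1⟩, fun h ↦ hZF h hx.2, rfl⟩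

lemma exists_curve_separating_of_infty_mem {Ω F : Set (OnePoint ℂ)} (hΩ : IsOpen Ω)
    (hΩc : IsConnected Ω) {e : OnePoint ℂ} (he : e ∈ Ωᶜ) (hF : IsClosed F) (hFΩ : F ⊆ Ωᶜ)
    (hEF : Disjoint (connectedComponentIn Ωᶜ e) F) (hinf : ∞ ∈ F) :
    ∃ γ : sphere (0 : ℂ) 1 → OnePoint ℂ, Continuous γ ∧ Function.Injective γ ∧ range γ ⊆ Ω ∧
      ∃ a ∈ (range γ)ᶜ, ∃ b ∈ (range γ)ᶜ,
        connectedComponentIn (range γ)ᶜ a ≠ connectedComponentIn (range γ)ᶜ b ∧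
        connectedComponentIn Ωᶜ e ⊆ connectedComponentIn (range γ)ᶜ a ∧
        F ⊆ connectedComponentIn (range γ)ᶜ b := by
  obtain ⟨O₁, O₂, hO₁, hO₂, hO, hΩO, hEO, hFO⟩ := exists_isOpen_connectedComponentIn_subset
    hΩ.isClosed_compl.isCompact hF he hEF
  rw [inter_eq_self_of_subset_right hFΩ] at hFO
  have hrange : ∀ {s : Set (OnePoint ℂ)}, ∞ ∉ s → s ⊆ range ((↑) : ℂ → OnePoint ℂ) :=
    fun hs x hx ↦ by_contra fun h ↦ hs (notMem_range_coe_iff.1 h ▸ hx)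
  have hΩinf : ∞ ∉ Ω := hFΩ hinf
  have hEinf : ∞ ∉ connectedComponentIn Ωᶜ e := disjoint_right.1 hEF hinf
  have heE := mem_connectedComponentIn he
  obtain ⟨e', rfl⟩ := hrange hEinf heE
  have hW : IsOpen ((↑) ⁻¹' Ω : Set ℂ) := hΩ.preimage continuous_coe
  have hWc : IsConnected ((↑) ⁻¹' Ω : Set ℂ) := by
    refine ⟨?_, hΩc.2.preimage_of_isOpenMap coe_injective isOpenMap_coe (hrange hΩinf)⟩
    obtain ⟨x, hx⟩ := hΩc.1
    obtain ⟨x, rfl⟩ := hrange hΩinf hx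
    exact ⟨x, hx⟩
  have hNb : Bornology.IsBounded ((↑) ⁻¹' O₁ : Set ℂ) :=
    ((isOpen_iff_of_mem (hFO hinf)).1 hO₂).2.isBounded.subset
      fun z hz hz' ↦ disjoint_left.1 hO hz hz'
  have hNW : frontier ((↑) ⁻¹' O₁ : Set ℂ) ⊆ (↑) ⁻¹' Ω := by
    intro z hz
    by_contra hzΩ
    have hN : IsOpen ((↑) ⁻¹' O₁ : Set ℂ) := hO₁.preimage continuous_coe
    rcases hΩO hzΩ with h | h
    · rw [frontier, hN.interior_eq] at hz
      exact hz.2 h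
    · obtain ⟨w, hw, hw'⟩ := mem_closure_iff.1 (frontier_subset_closure hz) _
        (hO₂.preimage continuous_coe) h
      exact disjoint_left.1 hO hw' hw
  obtain ⟨γ, hγ, hγi, hγW, U, V, hU, hV, hUV, hUVγ, hVc, hUb, hEU, hNV⟩ :=
    SquareGrid.exists_curve_of_frontier_subset
      (E := OnePoint.some ⁻¹' connectedComponentIn Ωᶜ (e' : OnePoint ℂ))
      hW hWc hNb hNW
      (isPreconnected_connectedComponentIn.preimage_of_isOpenMap coe_injective isOpenMap_coe
        (hrange hEinf))
      ⟨e', heE⟩ (fun z hz ↦ connectedComponentIn_subset Ωᶜ _ hz) (fun z hz ↦ hEO hz)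
  have hcompl : (range ((↑) ∘ γ : _ → OnePoint ℂ))ᶜ = (↑) '' U ∪ insert ∞ ((↑) '' V) := by
    rw [range_comp, compl_image_coe, ← hUVγ, image_union, union_insert, union_singleton]
  have hVcpt : IsCompact Vᶜ := by
    refine isCompact_of_isClosed_isBounded hV.isClosed_compl
      ((hUb.union (isCompact_range hγ).isBounded).subset fun z hz ↦ ?_)
    by_cases h : z ∈ range γ
    · exact .inr h
    · exact .inl ((hUVγ.symm ▸ h : z ∈ U ∪ V).resolve_right hz)
  have hVo : IsOpen (insert ∞ ((↑) '' V) : Set (OnePoint ℂ)) := by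
    have h : insert ∞ ((↑) '' V) = ((↑) '' Vᶜ : Set (OnePoint ℂ))ᶜ := by
      rw [compl_image_coe, compl_compl, union_singleton]
    rw [h, isOpen_compl_image_coe]
    exact ⟨hV.isClosed_compl, hVcpt⟩
  have hdisj : Disjoint ((↑) '' U) (insert ∞ ((↑) '' V) : Set (OnePoint ℂ)) := by
    rw [disjoint_insert_right]
    exact ⟨infty_notMem_image_coe, (disjoint_image_iff coe_injective).2 hUV⟩
  have hVc' : IsPreconnected (insert ∞ ((↑) '' V) : Set (OnePoint ℂ)) := by
    refine (hVc.image _ continuous_coe.continuousOn).subset_closure (subset_insert _ _) ?_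
    refine insert_subset ?_ subset_closure
    refine mem_closure_of_tendsto tendsto_coe_infty ?_
    filter_upwards [hVcpt.compl_mem_coclosedCompact_of_isClosed hV.isClosed_compl] with z hz
    exact ⟨z, compl_compl V ▸ hz, rfl⟩
  have heU : (e' : OnePoint ℂ) ∈ ((↑) '' U : Set (OnePoint ℂ)) := ⟨e', hEU heE, rfl⟩
  have hsubU : ((↑) '' U : Set (OnePoint ℂ)) ⊆ (range ((↑) ∘ γ))ᶜ := by
    rw [hcompl]; exact subset_union_left
  have hsubV : insert ∞ ((↑) '' V : Set (OnePoint ℂ)) ⊆ (range ((↑) ∘ γ))ᶜ := by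
    rw [hcompl]; exact subset_union_right
  have hVB : insert ∞ ((↑) '' V : Set (OnePoint ℂ)) ⊆
      connectedComponentIn (range ((↑) ∘ γ))ᶜ ∞ :=
    hVc'.subset_connectedComponentIn (mem_insert _ _) hsubV
  refine ⟨(↑) ∘ γ, continuous_coe.comp hγ, coe_injective.comp hγi, ?_, e', hsubU heU, ∞,
    hsubV (mem_insert _ _), ?_, ?_, ?_⟩
  · rintro _ ⟨t, rfl⟩
    exact hγW ⟨t, rfl⟩
  · intro h
    have hAU : connectedComponentIn (range ((↑) ∘ γ : _ → OnePoint ℂ))ᶜ e' ⊆ (↑) '' U :=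
      isPreconnected_connectedComponentIn.subset_left_of_subset_union
        (isOpen_image_coe.2 hU) hVo hdisj (hcompl ▸ connectedComponentIn_subset _ _)
        ⟨e', mem_connectedComponentIn (hsubU heU), heU⟩
    rw [h] at hAU
    exact infty_notMem_image_coe (hAU (hVB (mem_insert _ _)))
  · refine isPreconnected_connectedComponentIn.subset_connectedComponentIn heE fun x hx ↦ ?_
    obtain ⟨z, rfl⟩ := hrange hEinf hx
    exact hsubU ⟨z, hEU hx, rfl⟩
  · refine fun x hx ↦ hVB ?_
    induction x using OnePoint.rec with
    | infty => exact mem_insert _ _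
    | coe z =>
      exact .inr ⟨z, hNV ⟨hFΩ hx, fun h ↦ disjoint_left.1 hO h (hFO hx)⟩, rfl⟩

/-- The inversion `z ↦ z⁻¹` of the Riemann sphere. -/
noncomputable def sphereInv (x : OnePoint ℂ) : OnePoint ℂ :=
  x.elim ((0 : ℂ) : OnePoint ℂ) fun z ↦ if z = 0 then ∞ else (z⁻¹ : ℂ)

lemma sphereInv_infty : sphereInv ∞ = (0 : ℂ) := rfl

lemma sphereInv_zero : sphereInv (0 : ℂ) = ∞ := if_pos rfl

lemma sphereInv_coe {z : ℂ} (hz : z ≠ 0) : sphereInv z = (z⁻¹ : ℂ) := if_neg hz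

lemma involutive_sphereInv : Function.Involutive sphereInv := by
  intro x
  induction x using OnePoint.rec with
  | infty => rw [sphereInv_infty, sphereInv_zero]
  | coe z =>
    by_cases hz : z = 0
    · rw [hz, sphereInv_zero, sphereInv_infty]
    · rw [sphereInv_coe hz, sphereInv_coe (inv_ne_zero hz), inv_inv]

lemma continuous_sphereInv : Continuous sphereInv := by
  rw [OnePoint.continuous_iff]
  constructor
  · rw [Filter.coclosedCompact_eq_cocompact, ← Metric.cobounded_eq_cocompact]
    refine ((continuous_coe.tendsto (0 : ℂ)).comp Filter.tendsto_inv₀_cobounded).congr' ?_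
    filter_upwards [Bornology.eventually_ne_cobounded (0 : ℂ)] with z hz
    exact (sphereInv_coe hz).symm
  · rw [continuous_iff_continuousAt]
    intro z
    by_cases hz : z = 0
    · subst hz
      rw [ContinuousAt, sphereInv_zero, ← nhdsNE_sup_pure, Filter.tendsto_sup]
      constructor
      · have h : Filter.Tendsto ((↑) : ℂ → OnePoint ℂ) (Bornology.cobounded ℂ) (nhds ∞) := by
          rw [Metric.cobounded_eq_cocompact, ← Filter.coclosedCompact_eq_cocompact]
          exact tendsto_coe_infty
        refine (h.comp Filter.tendsto_inv₀_nhdsNE_zero).congr' ?_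
        filter_upwards [self_mem_nhdsWithin] with w hw
        exact (sphereInv_coe hw).symm
      · rw [Filter.tendsto_pure_left]
        intro s hs
        rw [sphereInv_zero]
        exact mem_of_mem_nhds hs
    · refine (continuous_coe.continuousAt.comp (continuousAt_inv₀ hz)).congr ?_
      filter_upwards [eventually_ne_nhds hz] with w hw
      exact (sphereInv_coe hw).symm

lemma exists_homeomorph_apply_eq_infty (x : OnePoint ℂ) :
    ∃ Φ : OnePoint ℂ ≃ₜ OnePoint ℂ, Φ x = ∞ := by
  induction x using OnePoint.rec with
  | infty => exact ⟨.refl _, rfl⟩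
  | coe z =>
    let Ψ : OnePoint ℂ ≃ₜ OnePoint ℂ :=
      ⟨involutive_sphereInv.toPerm, continuous_sphereInv, continuous_sphereInv⟩
    refine ⟨(Homeomorph.subRight z).onePointCongr.trans Ψ, ?_⟩
    change sphereInv ((z - z : ℂ) : OnePoint ℂ) = ∞
    rw [sub_self, sphereInv_zero]

/-- Separation lemma: if `Ω` is a domain in the Riemann sphere, `E` is a connected
component of its complement, and `F` is a nonempty closed subset of the complement
disjoint from `E`, then there is a simple closed curve (an injective continuous map
of the circle) contained in `Ω` whose complement has two distinct connected
components, one containing `E` and the other containing `F`. -/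
theorem separation_lemma (Ω : Set (OnePoint ℂ)) (E F : Set (OnePoint ℂ))
    (hΩ : IsSphereDomain Ω)
    (hE : ∃ e ∈ Ωᶜ, E = connectedComponentIn Ωᶜ e)
    (hFne : F.Nonempty) (hFcl : IsClosed F) (hFsub : F ⊆ Ωᶜ)
    (hEF : E ∩ F = ∅) :
    ∃ γ : Metric.sphere (0 : ℂ) 1 → OnePoint ℂ,
      Continuous γ ∧ Function.Injective γ ∧ Set.range γ ⊆ Ω ∧
      ∃ A B : Set (OnePoint ℂ),
        (∃ a ∈ (Set.range γ)ᶜ, A = connectedComponentIn (Set.range γ)ᶜ a) ∧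
        (∃ b ∈ (Set.range γ)ᶜ, B = connectedComponentIn (Set.range γ)ᶜ b) ∧
        A ≠ B ∧ E ⊆ A ∧ F ⊆ B := by
  obtain ⟨e, he, rfl⟩ := hE
  obtain ⟨x, hx⟩ := hFne
  obtain ⟨Φ, hΦ⟩ := exists_homeomorph_apply_eq_infty x
  have hcompl : (Φ '' Ω)ᶜ = Φ '' Ωᶜ := (image_compl_eq Φ.bijective).symm
  have himg : connectedComponentIn (Φ '' Ω)ᶜ (Φ e) = Φ '' connectedComponentIn Ωᶜ e := by
    rw [hcompl, Φ.image_connectedComponentIn he]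
  obtain ⟨γ, hγ, hγi, hγΩ, a, ha, b, hb, hab, hEa, hFb⟩ :=
    exists_curve_separating_of_infty_mem (Ω := Φ '' Ω) (F := Φ '' F) (e := Φ e)
      (Φ.isOpenMap _ hΩ.1) (hΩ.2.image _ Φ.continuous.continuousOn)
      (hcompl ▸ mem_image_of_mem Φ he) (Φ.isClosedMap _ hFcl) (hcompl ▸ image_mono hFsub)
      (by
        rw [himg, disjoint_image_iff Φ.injective]
        exact disjoint_iff_inter_eq_empty.2 hEF)
      ⟨x, hx, hΦ⟩
  have hrange : (range (Φ.symm ∘ γ))ᶜ = Φ.symm '' (range γ)ᶜ := by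
    rw [range_comp, image_compl_eq Φ.symm.bijective]
  have hcomp : ∀ c ∈ (range γ)ᶜ, connectedComponentIn (range (Φ.symm ∘ γ))ᶜ (Φ.symm c) =
      Φ.symm '' connectedComponentIn (range γ)ᶜ c := fun c hc ↦ by
    rw [hrange, Φ.symm.image_connectedComponentIn hc]
  refine ⟨Φ.symm ∘ γ, Φ.symm.continuous.comp hγ, Φ.symm.injective.comp hγi, ?_, _, _,
    ⟨Φ.symm a, hrange ▸ mem_image_of_mem _ ha, rfl⟩,
    ⟨Φ.symm b, hrange ▸ mem_image_of_mem _ hb, rfl⟩, ?_, ?_, ?_⟩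
  · rintro _ ⟨t, rfl⟩
    obtain ⟨y, hy, hyt⟩ := hγΩ ⟨t, rfl⟩
    simpa [← hyt] using hy
  · rw [hcomp a ha, hcomp b hb]
    exact fun h ↦ hab (Φ.symm.injective.image_injective h)
  · rw [hcomp a ha]
    exact fun y hy ↦ ⟨Φ y, hEa (himg ▸ mem_image_of_mem _ hy), Φ.symm_apply_apply y⟩
  · rw [hcomp b hb]
    exact fun y hy ↦ ⟨Φ y, hFb (mem_image_of_mem _ hy), Φ.symm_apply_apply y⟩
end
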